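/- arXiv:2002.07866 — 8 statements merged into one kernel-verified Lean document; each statement's English description precedes it below -/
import Mathlib

section
/- Let R be a left noetherian ring, M a left R-module, f : M → M an R-linear endomorphism, and X ⊆ M a finitely generated R-submodule. Then there exists k ∈ ℕ such that for every m ≥ k the restriction of f to the submodule f^m(X) (the image of X under the m-th iterate of f) is injective; since f always maps f^m(X) onto f^{m+1}(X), this means f restricts to an isomorphism f^m(X) ≅ f^{m+1}(X) for all m ≥ k. -/
/-!
Fitting-type lemma (existence part), Lemma 3.1 of the paper:
for a left noetherian ring `R`, a left `R`-module `M`, an `R`-linear endomorphism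
`f : M → M` and a finitely generated submodule `X ⊆ M`, there is `k ∈ ℕ` such that
for all `m ≥ k` the restriction of `f` to `f^m(X)` is injective; since `f` always maps
`f^m(X)` onto `f^{m+1}(X)`, this gives an isomorphism `f^m(X) ≅ f^{m+1}(X)` for `m ≥ k`.
-/

universe u v

theorem fitting_lemma_existence {R : Type u} [Ring R] [IsNoetherianRing R]
    {M : Type v} [AddCommGroup M] [Module R M]
    (f : M →ₗ[R] M) (X : Submodule R M) (hX : X.FG) :
    ∃ k : ℕ, ∀ m : ℕ, k ≤ m →
      Set.InjOn f (Submodule.map (f ^ m : M →ₗ[R] M) X : Set M) ∧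
      Submodule.map f (Submodule.map (f ^ m : M →ₗ[R] M) X) =
        Submodule.map (f ^ (m + 1) : M →ₗ[R] M) X := by
  haveI : IsNoetherian R X := isNoetherian_of_fg_of_noetherian X hX
  let K : ℕ →o Submodule R X :=
    ⟨fun n => LinearMap.ker ((f ^ n : M →ₗ[R] M).comp X.subtype), by
      refine monotone_nat_of_le_succ fun n x hx => ?_
      have hx' : (f ^ n) (x : M) = 0 := hx
      change (f ^ (n + 1)) (x : M) = 0
      rw [pow_succ', Module.End.mul_apply, hx', map_zero]⟩
  obtain ⟨k, hk⟩ := monotone_stabilizes_iff_noetherian.mpr this K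
  refine ⟨k, fun m hm => ⟨?_, ?_⟩⟩
  · rintro _ ⟨x, hx, rfl⟩ _ ⟨y, hy, rfl⟩ h
    have hmem : (⟨x - y, X.sub_mem hx hy⟩ : X) ∈ K (m + 1) := by
      change (f ^ (m + 1)) (x - y) = 0
      rw [pow_succ', Module.End.mul_apply, map_sub, map_sub, h, sub_self]
    rw [← hk (m + 1) (by omega), hk m hm] at hmem
    have h0 : (f ^ m) (x - y) = 0 := hmem
    rwa [map_sub, sub_eq_zero] at h0
  · rw [pow_succ', Module.End.mul_eq_comp, Submodule.map_comp]
end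

section
/- Let G be a free abelian group, D a subgroup of G, L : G → G a group endomorphism with L(D) ⊆ D, and k a positive integer such that the restriction of L to the subgroup L^k(D) is injective. Let L̄ : G/D → G/D be the induced endomorphism L̄(g + D) = L(g) + D, let X be a finitely generated subgroup of G, and let X̄ = (X + D)/D. If n ∈ ℕ is such that L̄ restricts to an isomorphism L̄^j(X̄) ≅ L̄^{j+1}(X̄) for all j ≥ n, then L restricts to an isomorphism L^m(X) ≅ L^{m+1}(X) for all m ≥ n + k. Consequently η_L(X) ≤ η_{L̄}(X̄) + k. -/
/-!
Lemma 3.3 of the paper. `G` is a free abelian group (formalized as a free `ℤ`-module,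
subgroups being `ℤ`-submodules and group endomorphisms being `ℤ`-linear maps),
`D ⊆ G` a subgroup with `L(D) ⊆ D`, and `k > 0` such that `L` is injective on `L^k(D)`.
If `L̄ : G/D → G/D` is the induced endomorphism, `X ⊆ G` is a finitely generated
subgroup, `X̄ = (X + D)/D`, and `L̄` restricts to an isomorphism
`L̄^j(X̄) ≅ L̄^{j+1}(X̄)` for all `j ≥ n` (equivalently `L̄` is injective on `L̄^j(X̄)`,
surjectivity being automatic), then `L` restricts to an isomorphism
`L^m(X) ≅ L^{m+1}(X)` for all `m ≥ n + k`; consequently `η_L(X) ≤ η_{L̄}(X̄) + k`.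
-/

universe u

theorem eta_quotient_bound {G : Type u} [AddCommGroup G] [Module.Free ℤ G]
    (D : Submodule ℤ G) (L : G →ₗ[ℤ] G) (hLD : D ≤ D.comap L)
    (k : ℕ) (hk : 0 < k)
    (hinjD : Set.InjOn L (Submodule.map (L ^ k : G →ₗ[ℤ] G) D : Set G))
    (X : Submodule ℤ G) (hX : X.FG) (n : ℕ)
    (hn : ∀ j : ℕ, n ≤ j →
      Set.InjOn (Submodule.mapQ D D L hLD)
        (Submodule.map ((Submodule.mapQ D D L hLD) ^ j : G ⧸ D →ₗ[ℤ] G ⧸ D)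
          (Submodule.map D.mkQ X) : Set (G ⧸ D))) :
    (∀ m : ℕ, n + k ≤ m → Set.InjOn L (Submodule.map (L ^ m : G →ₗ[ℤ] G) X : Set G)) ∧
    sInf {m : ℕ | ∀ j : ℕ, m ≤ j →
        Set.InjOn L (Submodule.map (L ^ j : G →ₗ[ℤ] G) X : Set G)} ≤ n + k := by
  have hpow : ∀ (j : ℕ) (g : G),
      ((Submodule.mapQ D D L hLD) ^ j) (D.mkQ g) = D.mkQ ((L ^ j) g) := by
    intro j g
    induction j with
    | zero => simp
    | succ j ih =>
      rw [pow_succ', pow_succ', Module.End.mul_apply, Module.End.mul_apply, ih]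
      simp
  have hstep : ∀ x ∈ X, ∀ j, n ≤ j → (L ^ (j + 1)) x ∈ D → (L ^ j) x ∈ D := by
    intro x hx j hj h
    have h0 : D.mkQ ((L ^ j) x) = 0 := by
      apply hn j hj
      · exact ⟨D.mkQ x, ⟨x, hx, rfl⟩, hpow j x⟩
      · exact Submodule.zero_mem _
      · rw [pow_succ', Module.End.mul_apply] at h
        rw [map_zero, Submodule.mkQ_apply, Submodule.mapQ_apply]
        exact (Submodule.Quotient.mk_eq_zero D).2 h
    exact (Submodule.Quotient.mk_eq_zero D).1 h0
  have hdesc : ∀ x ∈ X, ∀ j, n ≤ j → ∀ i, (L ^ (j + i)) x ∈ D → (L ^ j) x ∈ D := by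
    intro x hx j hj i
    induction i with
    | zero => exact id
    | succ i ih => exact fun h => ih (hstep x hx (j + i) (by omega) h)
  have main : ∀ m : ℕ, n + k ≤ m →
      Set.InjOn L (Submodule.map (L ^ m : G →ₗ[ℤ] G) X : Set G) := by
    rintro m hm _ ⟨a, ha, rfl⟩ _ ⟨b, hb, rfl⟩ hab
    have hx : a - b ∈ X := X.sub_mem ha hb
    have hz : L ((L ^ m) (a - b)) = 0 := by
      rw [map_sub, map_sub, hab, sub_self]
    have hD : (L ^ (m - k)) (a - b) ∈ D := by
      apply hdesc _ hx (m - k) (by omega) (k + 1)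
      rw [show m - k + (k + 1) = m + 1 by omega, pow_succ', Module.End.mul_apply, hz]
      exact D.zero_mem
    have h0 : (L ^ m) (a - b) = 0 := by
      apply hinjD
      · refine ⟨_, hD, ?_⟩
        rw [← Module.End.mul_apply, ← pow_add, show k + (m - k) = m by omega]
      · exact Submodule.zero_mem _
      · rw [hz, map_zero]
    rw [map_sub] at h0
    exact sub_eq_zero.1 h0
  exact ⟨main, Nat.sInf_le main⟩
end

section
/- Let Λ be an Artin algebra, D a resolving class of finitely generated left Λ-modules, and n, k ∈ ℕ. Then the following are equivalent: (i) for every finitely generated left Λ-module M, every n-th syzygy K of M satisfies resdim_D(K) ≤ k; (ii) for every finitely generated left Λ-module M, every (n+k)-th syzygy of M belongs to D. -/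
universe u

open CategoryTheory

/-- `ResolutionOfLength Λ D n M` : there is an exact sequence
`0 → X_n → ⋯ → X_1 → X_0 → M → 0` in `mod Λ` with all `X_i ∈ D`. -/
def ResolutionOfLength (Λ : Type u) [Ring Λ] (D : Set (ModuleCat.{u} Λ)) :
    ℕ → ModuleCat.{u} Λ → Prop
  | 0, M => ∃ X ∈ D, Nonempty ((X : Type u) ≃ₗ[Λ] (M : Type u))
  | n + 1, M => ∃ X ∈ D, ∃ (K : ModuleCat.{u} Λ) (f : K →ₗ[Λ] X) (g : X →ₗ[Λ] M),
      Function.Injective f ∧ Function.Surjective g ∧ Function.Exact f g ∧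
        ResolutionOfLength Λ D n K

/-- `ResdimLE Λ D k M` : the `D`-resolution dimension of `M` is at most `k`,
i.e. `M` admits a `D`-resolution of some length `n ≤ k`. -/
def ResdimLE (Λ : Type u) [Ring Λ] (D : Set (ModuleCat.{u} Λ)) (k : ℕ)
    (M : ModuleCat.{u} Λ) : Prop :=
  ∃ n ≤ k, ResolutionOfLength Λ D n M

/-- `IsSyzygy Λ m K M` : `K` is an `m`-th syzygy of `M`, i.e. there is an exact
sequence `0 → K → P_{m-1} → ⋯ → P_0 → M → 0` with each `P_i` finitely generated
projective (a `0`-th syzygy of `M` is `M` itself). -/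
def IsSyzygy (Λ : Type u) [Ring Λ] : ℕ → ModuleCat.{u} Λ → ModuleCat.{u} Λ → Prop
  | 0, K, M => Nonempty ((K : Type u) ≃ₗ[Λ] (M : Type u))
  | m + 1, K, M => ∃ (P : ModuleCat.{u} Λ), Module.Finite Λ P ∧ Module.Projective Λ P ∧
      ∃ (K₁ : ModuleCat.{u} Λ) (f : K₁ →ₗ[Λ] P) (g : P →ₗ[Λ] M),
        Function.Injective f ∧ Function.Surjective g ∧ Function.Exact f g ∧
          IsSyzygy Λ m K K₁

/-!
Lemma 4.1(b) of the paper: for an Artin algebra `Λ`, a resolving class `D` of finitely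
generated left `Λ`-modules and `n, k ∈ ℕ`, the following are equivalent:
(i) every `n`-th syzygy `K` of every finitely generated `M` satisfies `resdim_D(K) ≤ k`;
(ii) every `(n+k)`-th syzygy of every finitely generated `M` belongs to `D`.
That is, `resdim_D(Ω^n(mod Λ)) ≤ k ↔ Ω^{n+k}(mod Λ) ⊆ D`.
-/


/-- Bundled hypotheses on a resolving class. -/
structure IsResolvingAux (Λ : Type u) [Ring Λ] (D : Set (ModuleCat.{u} Λ)) : Prop where
  hfin : ∀ X ∈ D, Module.Finite Λ X
  hproj : ∀ P : ModuleCat.{u} Λ, Module.Finite Λ P → Module.Projective Λ P → P ∈ D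
  hext : ∀ (A B C : ModuleCat.{u} Λ) (f : A →ₗ[Λ] B) (g : B →ₗ[Λ] C),
      Module.Finite Λ B → Function.Injective f → Function.Surjective g →
      Function.Exact f g → A ∈ D → C ∈ D → B ∈ D
  hker : ∀ (K B C : ModuleCat.{u} Λ) (f : K →ₗ[Λ] B) (g : B →ₗ[Λ] C),
      Module.Finite Λ K → Function.Injective f → Function.Surjective g →
      Function.Exact f g → B ∈ D → C ∈ D → K ∈ D

namespace IsResolvingAux

variable {Λ : Type u} [Ring Λ] {D : Set (ModuleCat.{u} Λ)}

theorem zero_mem (h : IsResolvingAux Λ D) : ModuleCat.of Λ PUnit.{u+1} ∈ D :=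
  h.hproj _ (inferInstanceAs (Module.Finite Λ PUnit.{u+1}))
    (inferInstanceAs (Module.Projective Λ PUnit.{u+1}))

theorem iso_mem (h : IsResolvingAux Λ D) {A B : ModuleCat.{u} Λ} (e : A ≃ₗ[Λ] B)
    (hA : A ∈ D) : B ∈ D := by
  have := h.hfin A hA
  refine h.hext A B (ModuleCat.of Λ PUnit.{u+1}) e.toLinearMap 0 (Module.Finite.equiv e)
    e.injective (fun x => ⟨0, Subsingleton.elim (α := PUnit) _ _⟩) ?_ hA h.zero_mem
  intro y
  exact ⟨fun _ => e.surjective y, fun _ => rfl⟩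

theorem pad_one (h : IsResolvingAux Λ D) (k : ℕ) : ∀ M : ModuleCat.{u} Λ,
    ResolutionOfLength Λ D k M → ResolutionOfLength Λ D (k + 1) M := by
  induction k with
  | zero =>
    rintro M ⟨X, hX, ⟨e⟩⟩
    refine ⟨X, hX, ModuleCat.of Λ PUnit.{u+1}, 0, e.toLinearMap, ?_, e.surjective, ?_,
      ⟨_, h.zero_mem, ⟨LinearEquiv.refl _ _⟩⟩⟩
    · intro a b _
      exact Subsingleton.elim (α := PUnit) _ _
    · intro y
      constructor
      · intro hy
        exact ⟨0, (e.map_eq_zero_iff.1 hy).symm⟩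
      · rintro ⟨x, rfl⟩
        simp
  | succ k ih =>
    rintro M ⟨X, hX, K, f, g, hf, hg, hfg, hK⟩
    exact ⟨X, hX, K, f, g, hf, hg, hfg, ih K hK⟩

theorem pad (h : IsResolvingAux Λ D) {m k : ℕ} (hmk : m ≤ k) {M : ModuleCat.{u} Λ}
    (hM : ResolutionOfLength Λ D m M) : ResolutionOfLength Λ D k M := by
  induction k, hmk using Nat.le_induction with
  | base => exact hM
  | succ k _ ih => exact h.pad_one k M ih

/-- Extension of a finitely generated projective module by a module with a resolution. -/
theorem ext_proj (h : IsResolvingAux Λ D) (k : ℕ) (L E P : ModuleCat.{u} Λ)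
    (i : L →ₗ[Λ] E) (p : E →ₗ[Λ] P) (hE : Module.Finite Λ E)
    (hP : Module.Finite Λ P) (hP' : Module.Projective Λ P)
    (hi : Function.Injective i) (hp : Function.Surjective p) (hip : Function.Exact i p)
    (hL : ResolutionOfLength Λ D k L) : ResolutionOfLength Λ D k E := by
  cases k with
  | zero =>
    obtain ⟨X, hX, ⟨e⟩⟩ := hL
    exact ⟨E, h.hext L E P i p hE hi hp hip (h.iso_mem e hX) (h.hproj P hP hP'),
      ⟨LinearEquiv.refl _ _⟩⟩
  | succ k =>
    obtain ⟨X, hX, K, f, g, hf, hg, hfg, hK⟩ := hL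
    have := h.hfin X hX
    obtain ⟨s, hs⟩ := Module.projective_lifting_property p LinearMap.id hp
    have hs' : ∀ x, p (s x) = x := fun x => LinearMap.congr_fun hs x
    have hip' : ∀ x, p (i x) = 0 := fun x => (hip _).2 ⟨x, rfl⟩
    refine ⟨ModuleCat.of Λ (X × P), ?_, K, (LinearMap.inl Λ X P) ∘ₗ f,
      LinearMap.coprod (i ∘ₗ g) s, ?_, ?_, ?_, hK⟩
    · exact h.hext X (ModuleCat.of Λ (X × P)) P (LinearMap.inl Λ X P) (LinearMap.snd Λ X P)
        (inferInstanceAs (Module.Finite Λ (X × P))) LinearMap.inl_injective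
        LinearMap.snd_surjective Function.Exact.inl_snd hX (h.hproj P hP hP')
    · exact LinearMap.inl_injective.comp hf
    · intro y
      obtain ⟨l, hl⟩ := (hip (y - s (p y))).1 (by simp [hs'])
      obtain ⟨x, rfl⟩ := hg l
      refine ⟨((x, p y) : X × P), ?_⟩
      change i (g x) + s (p y) = y
      rw [hl]; simp
    · rintro ⟨x, q⟩
      change i (g x) + s q = 0 ↔ _
      constructor
      · intro hxq
        have hq : q = 0 := by
          have := congrArg p hxq
          simpa [hip', hs'] using this
        subst hq
        have : g x = 0 := hi (by simpa using hxq)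
        obtain ⟨z, rfl⟩ := (hfg x).1 this
        exact ⟨z, rfl⟩
      · rintro ⟨z, hz⟩
        have h1 : f z = x := congrArg Prod.fst hz
        have h2 : (0 : P) = q := congrArg Prod.snd hz
        have h3 : g (f z) = 0 := (hfg _).2 ⟨z, rfl⟩
        rw [← h1, ← h2, h3]; simp

/-- Kernel of an epimorphism from a module with a resolution onto an object of `D`. -/
theorem ker_res [IsNoetherianRing Λ] (h : IsResolvingAux Λ D) (k : ℕ) (K E X : ModuleCat.{u} Λ)
    (i : K →ₗ[Λ] E) (p : E →ₗ[Λ] X) (hK : Module.Finite Λ K)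
    (hi : Function.Injective i) (hp : Function.Surjective p) (hip : Function.Exact i p)
    (hX : X ∈ D)
    (hE : ResolutionOfLength Λ D k E) : ResolutionOfLength Λ D k K := by
  cases k with
  | zero =>
    obtain ⟨Y, hY, ⟨e⟩⟩ := hE
    exact ⟨K, h.hker K E X i p hK hi hp hip (h.iso_mem e hY) hX, ⟨LinearEquiv.refl _ _⟩⟩
  | succ k =>
    obtain ⟨Y, hY, E₁, f, g, hf, hg, hfg, hE₁⟩ := hE
    have := h.hfin Y hY
    let Z : Submodule Λ Y := LinearMap.ker (p ∘ₗ g)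
    have hfg' : ∀ x, g (f x) = 0 := fun x => (hfg _).2 ⟨x, rfl⟩
    have hZ : ∀ z : Z, g z ∈ LinearMap.range i := fun z => (hip _).1 z.2
    let e := LinearEquiv.ofInjective i hi
    let r : Z →ₗ[Λ] K := e.symm.toLinearMap ∘ₗ
      LinearMap.codRestrict (LinearMap.range i) (g ∘ₗ Z.subtype) hZ
    have hr : ∀ z : Z, i (r z) = g z := by
      intro z
      have := e.apply_symm_apply ⟨g z, hZ z⟩
      exact congrArg Subtype.val this
    refine ⟨ModuleCat.of Λ Z, ?_, E₁,
      LinearMap.codRestrict Z f (fun x => by simp [Z, hfg']), r, ?_, ?_, ?_, hE₁⟩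
    · refine h.hker (ModuleCat.of Λ Z) Y X Z.subtype (p ∘ₗ g)
        (inferInstanceAs (Module.Finite Λ Z)) Z.injective_subtype (hp.comp hg) ?_ hY hX
      exact LinearMap.exact_subtype_ker_map _
    · intro a b hab
      exact hf (congrArg Subtype.val hab)
    · intro x
      obtain ⟨y, hy⟩ := hg (i x)
      refine ⟨(⟨y, ?_⟩ : Z), ?_⟩
      · change p (g y) = 0
        rw [hy]; exact (hip _).2 ⟨x, rfl⟩
      · apply hi
        rw [hr]; exact hy
    · intro z
      constructor
      · intro hz
        have h1 : g z.1 = 0 := by rw [← hr z, hz]; simp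
        obtain ⟨x, hx⟩ := (hfg _).1 h1
        exact ⟨x, Subtype.ext hx⟩
      · rintro ⟨x, rfl⟩
        apply hi
        exact ((hr _).trans (hfg' x)).trans (map_zero i).symm

theorem syz_mem [IsNoetherianRing Λ] (h : IsResolvingAux Λ D) (k : ℕ) :
    ∀ (K L : ModuleCat.{u} Λ), ResolutionOfLength Λ D k L → IsSyzygy Λ k K L → K ∈ D := by
  induction k with
  | zero =>
    rintro K L ⟨X, hX, ⟨e⟩⟩ ⟨e'⟩
    exact h.iso_mem (e.trans e'.symm) hX
  | succ k ih =>
    rintro K L ⟨X, hX, L₁, f, g, hf, hg, hfg, hL₁⟩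
      ⟨P, hP, hP', K₁, f', g', hf', hg', hfg', hK₁⟩
    refine ih K K₁ ?_ hK₁
    have := h.hfin X hX
    have hgf : ∀ x, g (f x) = 0 := fun x => (hfg _).2 ⟨x, rfl⟩
    have hgf' : ∀ x, g' (f' x) = 0 := fun x => (hfg' _).2 ⟨x, rfl⟩
    let E : Submodule Λ (X × P) :=
      LinearMap.ker (g ∘ₗ LinearMap.fst Λ X P - g' ∘ₗ LinearMap.snd Λ X P)
    have hE : ∀ z : X × P, z ∈ E ↔ g z.1 = g' z.2 := by
      intro z
      simp [E, sub_eq_zero]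
    have hres : ResolutionOfLength Λ D k (ModuleCat.of Λ E) := by
      refine h.ext_proj k L₁ (ModuleCat.of Λ E) P
        (LinearMap.codRestrict E (LinearMap.inl Λ X P ∘ₗ f) (fun x => by simp [hE, hgf]))
        (LinearMap.snd Λ X P ∘ₗ E.subtype) (inferInstanceAs (Module.Finite Λ E)) hP hP'
        ?_ ?_ ?_ hL₁
      · intro a b hab
        exact hf (congrArg (fun z : E => z.1.1) hab)
      · intro q
        obtain ⟨x, hx⟩ := hg (g' q)
        exact ⟨(⟨(x, q), (hE _).2 hx⟩ : E), rfl⟩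
      · rintro ⟨⟨x, q⟩, hz⟩
        have hz' : g x = g' q := (hE _).1 hz
        change q = 0 ↔ _
        constructor
        · rintro rfl
          obtain ⟨y, rfl⟩ := (hfg x).1 (by simpa using hz')
          exact ⟨y, rfl⟩
        · rintro ⟨y, hy⟩
          exact (congrArg (fun z : E => z.1.2) hy).symm
    refine h.ker_res k K₁ (ModuleCat.of Λ E) X
        (LinearMap.codRestrict E (LinearMap.inr Λ X P ∘ₗ f') (fun x => by simp [hE, hgf']))
        (LinearMap.fst Λ X P ∘ₗ E.subtype) (Module.Finite.of_injective f' hf') ?_ ?_ ?_ hX hres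
    · intro a b hab
      exact hf' (congrArg (fun z : E => z.1.2) hab)
    · intro x
      obtain ⟨q, hq⟩ := hg' (g x)
      exact ⟨(⟨(x, q), (hE _).2 hq.symm⟩ : E), rfl⟩
    · rintro ⟨⟨x, q⟩, hz⟩
      have hz' : g x = g' q := (hE _).1 hz
      change x = 0 ↔ _
      constructor
      · rintro rfl
        obtain ⟨y, rfl⟩ := (hfg' q).1 (by simpa using hz'.symm)
        exact ⟨y, rfl⟩
      · rintro ⟨y, hy⟩
        exact (congrArg (fun z : E => z.1.1) hy).symm

theorem syz_res (h : IsResolvingAux Λ D) (k : ℕ) : ∀ (K L : ModuleCat.{u} Λ), K ∈ D →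
    IsSyzygy Λ k K L → ResolutionOfLength Λ D k L := by
  induction k with
  | zero => exact fun K L hK e => ⟨K, hK, e⟩
  | succ k ih =>
    rintro K L hK ⟨P, hP, hP', K₁, f, g, hf, hg, hfg, hK₁⟩
    exact ⟨P, h.hproj P hP hP', K₁, f, g, hf, hg, hfg, ih K K₁ hK hK₁⟩

theorem syz_exists [IsNoetherianRing Λ] (k : ℕ) : ∀ L : ModuleCat.{u} Λ, Module.Finite Λ L →
    ∃ K, IsSyzygy Λ k K L := by
  induction k with
  | zero => exact fun L _ => ⟨L, ⟨LinearEquiv.refl _ _⟩⟩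
  | succ k ih =>
    intro L hL
    obtain ⟨m, g, hg⟩ := Module.Finite.exists_fin' Λ L
    obtain ⟨K, hK⟩ := ih (ModuleCat.of Λ (LinearMap.ker g))
      (inferInstanceAs (Module.Finite Λ (LinearMap.ker g)))
    exact ⟨K, ModuleCat.of Λ (Fin m → Λ), inferInstanceAs (Module.Finite Λ (Fin m → Λ)),
      inferInstanceAs (Module.Projective Λ (Fin m → Λ)), ModuleCat.of Λ (LinearMap.ker g),
      (LinearMap.ker g).subtype, g, (LinearMap.ker g).injective_subtype, hg,
      LinearMap.exact_subtype_ker_map g, hK⟩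

theorem syz_iso (k : ℕ) (K L M : ModuleCat.{u} Λ) (e : L ≃ₗ[Λ] M) (hK : IsSyzygy Λ k K L) :
    IsSyzygy Λ k K M := by
  cases k with
  | zero =>
    obtain ⟨e'⟩ := hK
    exact ⟨e'.trans e⟩
  | succ k =>
    obtain ⟨P, hP, hP', K₁, f, g, hf, hg, hfg, hK₁⟩ := hK
    refine ⟨P, hP, hP', K₁, f, e.toLinearMap ∘ₗ g, hf, e.surjective.comp hg, ?_, hK₁⟩
    intro y
    rw [← hfg y]
    simp

theorem syz_comp (n k : ℕ) (K L : ModuleCat.{u} Λ) (hK : IsSyzygy Λ k K L) :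
    ∀ M, IsSyzygy Λ n L M → IsSyzygy Λ (n + k) K M := by
  induction n with
  | zero =>
    rintro M ⟨e⟩
    rw [Nat.zero_add]
    exact syz_iso k K L M e hK
  | succ n ih =>
    rintro M ⟨P, hP, hP', K₁, f, g, hf, hg, hfg, hK₁⟩
    rw [Nat.add_right_comm]
    exact ⟨P, hP, hP', K₁, f, g, hf, hg, hfg, ih K₁ hK₁⟩

theorem syz_split (n k : ℕ) (K : ModuleCat.{u} Λ) :
    ∀ M, IsSyzygy Λ (n + k) K M → ∃ L, IsSyzygy Λ n L M ∧ IsSyzygy Λ k K L := by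
  induction n with
  | zero =>
    intro M hM
    rw [Nat.zero_add] at hM
    exact ⟨M, ⟨LinearEquiv.refl _ _⟩, hM⟩
  | succ n ih =>
    intro M hM
    rw [Nat.add_right_comm] at hM
    obtain ⟨P, hP, hP', K₁, f, g, hf, hg, hfg, hK₁⟩ := hM
    obtain ⟨L, hL, hL'⟩ := ih K₁ hK₁
    exact ⟨L, ⟨P, hP, hP', K₁, f, g, hf, hg, hfg, hL⟩, hL'⟩

theorem syz_finite [IsNoetherianRing Λ] (n : ℕ) : ∀ K M : ModuleCat.{u} Λ, Module.Finite Λ M →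
    IsSyzygy Λ n K M → Module.Finite Λ K := by
  induction n with
  | zero =>
    rintro K M hM ⟨e⟩
    exact Module.Finite.equiv e.symm
  | succ n ih =>
    rintro K M hM ⟨P, hP, hP', K₁, f, g, hf, hg, hfg, hK₁⟩
    exact ih K K₁ (Module.Finite.of_injective f hf) hK₁

end IsResolvingAux

theorem resdim_syzygy_iff
    {R : Type u} [CommRing R] [IsArtinianRing R]
    {Λ : Type u} [Ring Λ] [Algebra R Λ] [Module.Finite R Λ]
    (D : Set (ModuleCat.{u} Λ))
    (hDfin : ∀ X ∈ D, Module.Finite Λ X)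
    (hDproj : ∀ P : ModuleCat.{u} Λ, Module.Finite Λ P → Module.Projective Λ P → P ∈ D)
    (hDext : ∀ (A B C : ModuleCat.{u} Λ) (f : A →ₗ[Λ] B) (g : B →ₗ[Λ] C),
      Module.Finite Λ B → Function.Injective f → Function.Surjective g →
      Function.Exact f g → A ∈ D → C ∈ D → B ∈ D)
    (hDker : ∀ (K B C : ModuleCat.{u} Λ) (f : K →ₗ[Λ] B) (g : B →ₗ[Λ] C),
      Module.Finite Λ K → Function.Injective f → Function.Surjective g →
      Function.Exact f g → B ∈ D → C ∈ D → K ∈ D)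
    (n k : ℕ) :
    (∀ M : ModuleCat.{u} Λ, Module.Finite Λ M →
        ∀ K : ModuleCat.{u} Λ, IsSyzygy Λ n K M → ResdimLE Λ D k K) ↔
    (∀ M : ModuleCat.{u} Λ, Module.Finite Λ M →
        ∀ K : ModuleCat.{u} Λ, IsSyzygy Λ (n + k) K M → K ∈ D) := by
  have h : IsResolvingAux Λ D := ⟨hDfin, hDproj, hDext, hDker⟩
  have : IsNoetherianRing Λ := IsNoetherianRing.of_finite R Λ
  constructor
  · intro H M hM K hK
    obtain ⟨L, hL, hKL⟩ := IsResolvingAux.syz_split n k K M hK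
    obtain ⟨m, hm, hres⟩ := H M hM L hL
    exact h.syz_mem k K L (h.pad hm hres) hKL
  · intro H M hM L hL
    have hLfin := IsResolvingAux.syz_finite n L M hM hL
    obtain ⟨K, hK⟩ := IsResolvingAux.syz_exists k L hLfin
    exact ⟨k, le_rfl, h.syz_res k K L (H M hM K (IsResolvingAux.syz_comp n k K L hK M hL)) hK⟩
end

section
/- Let Λ be an Artin algebra, D a class of finitely generated left Λ-modules closed under extensions and direct summands, and ω a class closed under direct summands which is a D-injective relative cogenerator in D. Fix n, d ∈ ℕ and assume that every n-th syzygy of every finitely generated left Λ-module has finite D-resolution dimension, and that every W ∈ ω has injective dimension at most d as a Λ-module. Then every n-th syzygy of every finitely generated left Λ-module has D-resolution dimension at most d. -/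
universe u

open CategoryTheory

/-- `ExtGrp Λ i M N` is the `i`-th Ext group `Ext^i_Λ(M, N)`, computed in the abelian
category of `Λ`-modules. Its vanishing is expressed as `Subsingleton (ExtGrp Λ i M N)`. -/
noncomputable abbrev ExtGrp (Λ : Type u) [Ring Λ] (i : ℕ) (M N : ModuleCat.{u} Λ) :
    Type u :=
  ((Ext ℤ (ModuleCat.{u} Λ) i).obj (Opposite.op M)).obj N

/-!
Lemma 4.3 of the paper (the inequality `resdim_D(Ω^n(mod Λ)) ≤ id(ω)`):
`Λ` is an Artin algebra, `D` a class of finitely generated left `Λ`-modules closed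
under extensions and direct summands, `ω` a class closed under direct summands which
is a `D`-injective relative cogenerator in `D`. If every `n`-th syzygy of every
finitely generated module has finite `D`-resolution dimension, and every `W ∈ ω` has
injective dimension at most `d` (i.e. `Ext^j(M, W) = 0` for all `j > d` and all `M`),
then every `n`-th syzygy of every finitely generated module has `D`-resolution
dimension at most `d`.
-/

namespace SyzAux

/-- Vanishing of the derived-functor Ext group implies vanishing of Yoneda Ext. -/
lemma ext_subsingleton {Λ : Type u} [Ring Λ] (i : ℕ) (hi : 1 ≤ i) (M N : ModuleCat.{u} Λ)
    (h : Subsingleton (ExtGrp Λ i M N)) : Subsingleton (Abelian.Ext.{u} M N i) := by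
  obtain ⟨p, rfl⟩ : ∃ p, i = p + 1 := ⟨i - 1, by omega⟩
  let P := projectiveResolution M
  have h1 : Limits.IsZero ((P.complex.linearYonedaObj ℤ N).homology (p + 1)) :=
    Limits.IsZero.of_iso (ModuleCat.isZero_of_subsingleton
      (((Ext ℤ (ModuleCat.{u} Λ) (p + 1)).obj (Opposite.op M)).obj N)) (P.isoExt (R := ℤ) (p + 1) N).symm
  rw [← HomologicalComplex.exactAt_iff_isZero_homology,
    HomologicalComplex.exactAt_iff' _ p (p + 1) (p + 2) (by simp) (by simp),
    ShortComplex.moduleCat_exact_iff] at h1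
  refine subsingleton_of_forall_eq 0 fun α => ?_
  obtain ⟨f, hf, rfl⟩ := P.extMk_surjective α (p + 2) rfl
  rw [P.extMk_eq_zero_iff f (p + 2) rfl hf p rfl]
  obtain ⟨g, hg⟩ := h1 f hf
  exact ⟨g, hg⟩

section
variable {Λ : Type u} [Ring Λ] {A B C : ModuleCat.{u} Λ} (f : A →ₗ[Λ] B) (g : B →ₗ[Λ] C)

lemma shortExact (hf : Function.Injective f) (hg : Function.Surjective g)
    (h : Function.Exact f g) :
    (ShortComplex.mk (ModuleCat.ofHom f) (ModuleCat.ofHom g)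
      (by ext x; exact h.apply_apply_eq_zero x)).ShortExact := by
  refine ShortComplex.ShortExact.mk' ?_ ?_ ?_
  · exact (ShortComplex.ShortExact.moduleCat_exact_iff_function_exact _).2 h
  · exact (ModuleCat.mono_iff_injective _).2 hf
  · exact (ModuleCat.epi_iff_surjective _).2 hg

lemma ext_left (hf : Function.Injective f) (hg : Function.Surjective g)
    (h : Function.Exact f g) (W : ModuleCat.{u} Λ) (j : ℕ)
    (hB : Subsingleton (Abelian.Ext.{u} B W j)) (hC : Subsingleton (Abelian.Ext.{u} C W (j + 1))) :
    Subsingleton (Abelian.Ext.{u} A W j) := by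
  refine subsingleton_of_forall_eq 0 fun α => ?_
  obtain ⟨x, hx⟩ := Abelian.Ext.contravariant_sequence_exact₁ (shortExact f g hf hg h) W α
    (n₁ := j + 1) (by omega) (@Subsingleton.elim _ hC _ _)
  rw [← hx, @Subsingleton.elim _ hB x 0, Abelian.Ext.comp_zero]

lemma ext_right (hf : Function.Injective f) (hg : Function.Surjective g)
    (h : Function.Exact f g) (M : ModuleCat.{u} Λ) (j : ℕ)
    (hB : Subsingleton (Abelian.Ext.{u} M B j)) (hA : Subsingleton (Abelian.Ext.{u} M A (j + 1))) :
    Subsingleton (Abelian.Ext.{u} M C j) := by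
  refine subsingleton_of_forall_eq 0 fun α => ?_
  obtain ⟨x, hx⟩ := Abelian.Ext.covariant_sequence_exact₃ M (shortExact f g hf hg h) α
    (n₁ := j + 1) rfl (@Subsingleton.elim _ hA _ _)
  rw [← hx, @Subsingleton.elim _ hB x 0, Abelian.Ext.zero_comp]

lemma ext_split (hf : Function.Injective f) (hg : Function.Surjective g)
    (h : Function.Exact f g) (hA : Subsingleton (Abelian.Ext.{u} C A 1)) :
    ∃ s : C →ₗ[Λ] B, g ∘ₗ s = LinearMap.id := by
  obtain ⟨x, hx⟩ := Abelian.Ext.covariant_sequence_exact₃ C (shortExact f g hf hg h)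
    (Abelian.Ext.mk₀ (𝟙 C)) (n₁ := 1) rfl (@Subsingleton.elim _ hA _ _)
  obtain ⟨s, rfl⟩ := (Abelian.Ext.mk₀_bijective _ _).2 x
  rw [Abelian.Ext.mk₀_comp_mk₀] at hx
  have h2 := (Abelian.Ext.mk₀_bijective _ _).1 hx
  exact ⟨s.hom, congrArg ModuleCat.Hom.hom h2⟩

lemma split_prod (hf : Function.Injective f)
    (h : Function.Exact f g) (s : C →ₗ[Λ] B) (hs : g ∘ₗ s = LinearMap.id) :
    Nonempty (B ≃ₗ[Λ] (↥C × ↥A)) := by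
  have h0 : Function.Injective f ∧ ∃ l : C →ₗ[Λ] B, g ∘ₗ l = LinearMap.id := ⟨hf, s, hs⟩
  obtain ⟨e, -⟩ := (h.split_tfae'.out 0 2 rfl rfl).1 h0
  exact ⟨e.trans (LinearEquiv.prodComm Λ A C)⟩

lemma finite_mid (h : Function.Exact f g) (hg : Function.Surjective g)
    (hA : Module.Finite Λ A) (hC : Module.Finite Λ C) :
    Module.Finite Λ B := by
  refine ⟨Submodule.fg_of_fg_map_of_fg_inf_ker g ?_ ?_⟩
  · rw [Submodule.map_top, LinearMap.range_eq_top.2 hg]; exact hC.1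
  · rw [top_inf_eq, h.linearMap_ker_eq]; exact (LinearMap.range_eq_map f) ▸ hA.1.map f

lemma pushout (hf : Function.Injective f) (hg : Function.Surjective g)
    (h : Function.Exact f g) {Y E : ModuleCat.{u} Λ} (a : A →ₗ[Λ] Y) (b : Y →ₗ[Λ] E)
    (ha : Function.Injective a) (hb : Function.Surjective b) (hab : Function.Exact a b) :
    ∃ (P : ModuleCat.{u} Λ) (i : Y →ₗ[Λ] P) (p : P →ₗ[Λ] C) (q : B →ₗ[Λ] P) (r : P →ₗ[Λ] E),
      (Function.Injective i ∧ Function.Surjective p ∧ Function.Exact i p) ∧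
      (Function.Injective q ∧ Function.Surjective r ∧ Function.Exact q r) := by
  let S : Submodule Λ (B × Y) := LinearMap.range (f.prod (-a))
  have hS : ∀ x y, (x, y) ∈ S ↔ ∃ k, f k = x ∧ -a k = y := by
    intro x y; simp [S, LinearMap.mem_range]
  let p : (↥B × ↥Y) ⧸ S →ₗ[Λ] C := S.liftQ (g ∘ₗ LinearMap.fst Λ B Y) (by
    rintro ⟨x, y⟩ hxy
    obtain ⟨k, rfl, rfl⟩ := (hS _ _).1 hxy
    simp [h.apply_apply_eq_zero])
  let r : (↥B × ↥Y) ⧸ S →ₗ[Λ] E := S.liftQ (b ∘ₗ LinearMap.snd Λ B Y) (by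
    rintro ⟨x, y⟩ hxy
    obtain ⟨k, rfl, rfl⟩ := (hS _ _).1 hxy
    simp [hab.apply_apply_eq_zero])
  refine ⟨ModuleCat.of Λ ((↥B × ↥Y) ⧸ S), S.mkQ ∘ₗ LinearMap.inr Λ B Y, p,
    S.mkQ ∘ₗ LinearMap.inl Λ B Y, r, ⟨?_, ?_, ?_⟩, ⟨?_, ?_, ?_⟩⟩
  · refine (injective_iff_map_eq_zero _).2 fun y hy => ?_
    have : ((0 : B), y) ∈ S := (Submodule.Quotient.mk_eq_zero S).1 hy
    obtain ⟨k, hk, rfl⟩ := (hS _ _).1 this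
    rw [(injective_iff_map_eq_zero f).1 hf k hk]; simp
  · intro c
    obtain ⟨x, rfl⟩ := hg c
    exact ⟨S.mkQ (x, 0), rfl⟩
  · intro z
    obtain ⟨⟨x, y⟩, rfl⟩ := S.mkQ_surjective z
    constructor
    · intro hz
      obtain ⟨k, rfl⟩ := (h x).1 hz
      refine ⟨y + a k, ?_⟩
      refine (Submodule.Quotient.eq S).2 ((hS _ _).2 ⟨-k, ?_, ?_⟩) <;> simp
    · rintro ⟨w, hw⟩
      rw [← hw]
      exact g.map_zero
  · refine (injective_iff_map_eq_zero _).2 fun y hy => ?_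
    have : (y, (0 : Y)) ∈ S := (Submodule.Quotient.mk_eq_zero S).1 hy
    obtain ⟨k, rfl, hk⟩ := (hS _ _).1 this
    rw [(injective_iff_map_eq_zero a).1 ha k (neg_eq_zero.1 hk)]; simp
  · intro c
    obtain ⟨x, rfl⟩ := hb c
    exact ⟨S.mkQ (0, x), rfl⟩
  · intro z
    obtain ⟨⟨x, y⟩, rfl⟩ := S.mkQ_surjective z
    constructor
    · intro hz
      obtain ⟨k, rfl⟩ := (hab y).1 hz
      refine ⟨x + f k, ?_⟩
      refine (Submodule.Quotient.eq S).2 ((hS _ _).2 ⟨k, ?_, ?_⟩) <;> simp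
    · rintro ⟨w, hw⟩
      rw [← hw]
      exact b.map_zero

/-- `0 → A → B → C → 0` and `0 → B → W → E → 0` exact; then with `Q = W / A`, both
`0 → A → W → Q → 0` and `0 → C → Q → E → 0` are exact. -/
lemma cokernels (hf : Function.Injective f) (hg : Function.Surjective g)
    (h : Function.Exact f g) {W E : ModuleCat.{u} Λ} (a : B →ₗ[Λ] W) (b : W →ₗ[Λ] E)
    (ha : Function.Injective a) (hb : Function.Surjective b) (hab : Function.Exact a b) :
    ∃ (Q : ModuleCat.{u} Λ) (i : A →ₗ[Λ] W) (p : W →ₗ[Λ] Q) (q : C →ₗ[Λ] Q) (r : Q →ₗ[Λ] E),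
      (Function.Injective i ∧ Function.Surjective p ∧ Function.Exact i p) ∧
      (Function.Injective q ∧ Function.Surjective r ∧ Function.Exact q r) := by
  let S : Submodule Λ W := LinearMap.range (a ∘ₗ f)
  let e : (B ⧸ LinearMap.ker g) ≃ₗ[Λ] C := g.quotKerEquivOfSurjective hg
  have he : ∀ x, e.symm (g x) = (LinearMap.ker g).mkQ x := fun x => by
    rw [LinearEquiv.symm_apply_eq]; rfl
  let q0 : (B ⧸ LinearMap.ker g) →ₗ[Λ] W ⧸ S := (LinearMap.ker g).mapQ S a (by
    intro x hx
    obtain ⟨k, rfl⟩ := (h x).1 hx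
    exact ⟨k, rfl⟩)
  let q : C →ₗ[Λ] W ⧸ S := q0 ∘ₗ e.symm.toLinearMap
  have hq : ∀ x, q (g x) = S.mkQ (a x) := fun x => by
    change q0 (e.symm (g x)) = _
    rw [he]; rfl
  let r : (W ⧸ S) →ₗ[Λ] E := S.liftQ b (by
    rintro _ ⟨k, rfl⟩
    exact hab.apply_apply_eq_zero _)
  refine ⟨ModuleCat.of Λ (W ⧸ S), a ∘ₗ f, S.mkQ, q, r,
    ⟨ha.comp hf, S.mkQ_surjective, ?_⟩, ?_, ?_, ?_⟩
  · exact LinearMap.exact_map_mkQ_range _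
  · refine (injective_iff_map_eq_zero q).2 fun c hc => ?_
    obtain ⟨x, rfl⟩ := hg c
    rw [hq] at hc
    obtain ⟨k, hk⟩ := (Submodule.Quotient.mk_eq_zero S).1 hc
    rw [← ha hk]
    exact h.apply_apply_eq_zero _
  · intro c
    obtain ⟨x, rfl⟩ := hb c
    exact ⟨S.mkQ x, rfl⟩
  · intro z
    obtain ⟨w, rfl⟩ := S.mkQ_surjective z
    constructor
    · intro hz
      obtain ⟨k, rfl⟩ := (hab w).1 hz
      exact ⟨g k, hq k⟩
    · rintro ⟨c, hc⟩
      obtain ⟨x, rfl⟩ := hg c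
      rw [← hc, hq]
      exact hab.apply_apply_eq_zero _

end

section
variable {Λ : Type u} [Ring Λ] {D ω : Set (ModuleCat.{u} Λ)}

lemma mem_of_equiv
    (hDsum : ∀ B ∈ D, ∀ (M N : ModuleCat.{u} Λ),
      Nonempty ((B : Type u) ≃ₗ[Λ] (↥M × ↥N)) → M ∈ D)
    (X M : ModuleCat.{u} Λ) (hX : X ∈ D) (e : X ≃ₗ[Λ] M) : M ∈ D :=
  hDsum X hX M (ModuleCat.of Λ PUnit.{u + 1}) ⟨e.trans (LinearEquiv.prodUnique).symm⟩

/-- `M` embeds in a module with an `ω`-resolution of length `k`, with cokernel in `D`;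
if `k = m + 1`, there is also a `D`-approximation. -/
lemma approx
    (hDfin : ∀ X ∈ D, Module.Finite Λ X)
    (hDext : ∀ (A B C : ModuleCat.{u} Λ) (f : A →ₗ[Λ] B) (g : B →ₗ[Λ] C),
      Module.Finite Λ B → Function.Injective f → Function.Surjective g →
      Function.Exact f g → A ∈ D → C ∈ D → B ∈ D)
    (hDsum : ∀ B ∈ D, ∀ (M N : ModuleCat.{u} Λ),
      Nonempty ((B : Type u) ≃ₗ[Λ] (↥M × ↥N)) → M ∈ D)
    (hωcog : ∀ X ∈ D, ∃ W ∈ ω, ∃ X' ∈ D,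
      ∃ (f : (X : Type u) →ₗ[Λ] (W : Type u)) (g : (W : Type u) →ₗ[Λ] (X' : Type u)),
        Function.Injective f ∧ Function.Surjective g ∧ Function.Exact f g)
    (k : ℕ) : ∀ M : ModuleCat.{u} Λ, ResolutionOfLength Λ D k M →
      (∃ (Y X' : ModuleCat.{u} Λ) (f : M →ₗ[Λ] Y) (g : Y →ₗ[Λ] X'),
        Function.Injective f ∧ Function.Surjective g ∧ Function.Exact f g ∧ X' ∈ D ∧
        ResolutionOfLength Λ ω k Y) ∧
      (∀ m, k = m + 1 → ∃ (Y X : ModuleCat.{u} Λ) (f : Y →ₗ[Λ] X) (g : X →ₗ[Λ] M),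
        Function.Injective f ∧ Function.Surjective g ∧ Function.Exact f g ∧ X ∈ D ∧
        ResolutionOfLength Λ ω m Y) := by
  induction k with
  | zero =>
    rintro M ⟨X, hX, ⟨e⟩⟩
    obtain ⟨W, hW, X', hX', f, g, h1, h2, h3⟩ := hωcog M (mem_of_equiv hDsum X M hX e)
    exact ⟨⟨W, X', f, g, h1, h2, h3, hX', W, hW, ⟨LinearEquiv.refl Λ W⟩⟩,
      fun m hm => by omega⟩
  | succ k ih =>
    rintro M ⟨X, hX, K, f, g, hf, hg, hfg, hK⟩
    obtain ⟨⟨Y, X', a, b, ha, hb, hab, hX', hY⟩, -⟩ := ih K hK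
    obtain ⟨P, i, p, q, r, ⟨hi, hp, hip⟩, hq, hr, hqr⟩ := pushout f g hf hg hfg a b ha hb hab
    have hP : P ∈ D := hDext X P X' q r (finite_mid q r hqr hr (hDfin _ hX) (hDfin _ hX'))
      hq hr hqr hX hX'
    obtain ⟨W, hW, X'', hX'', a', b', ha', hb', hab'⟩ := hωcog P hP
    obtain ⟨Q, i', p', q', r', ⟨hi', hp', hip'⟩, hq', hr', hqr'⟩ :=
      cokernels i p hi hp hip a' b' ha' hb' hab'
    refine ⟨⟨Q, X'', q', r', hq', hr', hqr', hX'', W, hW, Y, i', p', hi', hp', hip', hY⟩, ?_⟩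
    intro m hm
    obtain rfl : k = m := by omega
    exact ⟨Y, P, i, p, hi, hp, hip, hP, hY⟩

lemma ext_of_resolution (hωsum : ∀ B ∈ ω, ∀ (M N : ModuleCat.{u} Λ),
      Nonempty ((B : Type u) ≃ₗ[Λ] (↥M × ↥N)) → M ∈ ω)
    (M : ModuleCat.{u} Λ)
    (hM : ∀ W ∈ ω, ∀ j, 1 ≤ j → Subsingleton (Abelian.Ext.{u} M W j)) (m : ℕ) :
    ∀ Y : ModuleCat.{u} Λ, ResolutionOfLength Λ ω m Y →
      ∀ j, 1 ≤ j → Subsingleton (Abelian.Ext.{u} M Y j) := by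
  induction m with
  | zero =>
    rintro Y ⟨X, hX, ⟨e⟩⟩ j hj
    exact hM Y (mem_of_equiv hωsum X Y hX e) j hj
  | succ m ih =>
    rintro Y ⟨W, hW, K, f, g, hf, hg, hfg, hK⟩ j hj
    exact ext_right f g hf hg hfg M j (hM W hW j hj) (ih K hK (j + 1) (by omega))

lemma reduce
    (hDsum : ∀ B ∈ D, ∀ (M N : ModuleCat.{u} Λ),
      Nonempty ((B : Type u) ≃ₗ[Λ] (↥M × ↥N)) → M ∈ D)
    (hωsum : ∀ B ∈ ω, ∀ (M N : ModuleCat.{u} Λ),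
      Nonempty ((B : Type u) ≃ₗ[Λ] (↥M × ↥N)) → M ∈ ω)
    (hωD : ω ⊆ D)
    (hωinj : ∀ i : ℕ, 1 ≤ i → ∀ A ∈ D, ∀ W ∈ ω, Subsingleton (Abelian.Ext.{u} A W i))
    (d : ℕ) : ∀ (M X Y : ModuleCat.{u} Λ) (f : Y →ₗ[Λ] X) (g : X →ₗ[Λ] M),
      Function.Injective f → Function.Surjective g → Function.Exact f g → X ∈ D →
      ∀ m, ResolutionOfLength Λ ω m Y →
      (∀ W ∈ ω, ∀ j, d < j → Subsingleton (Abelian.Ext.{u} M W j)) → ResdimLE Λ D d M := by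
  induction d with
  | zero =>
    intro M X Y f g hf hg hfg hX m hY hM
    obtain ⟨s, hs⟩ := ext_split f g hf hg hfg
      (ext_of_resolution hωsum M (fun W hW j hj => hM W hW j hj) m Y hY 1 le_rfl)
    exact ⟨0, le_rfl, M, hDsum X hX M Y (split_prod f g hf hfg s hs), ⟨LinearEquiv.refl Λ M⟩⟩
  | succ d ih =>
    intro M X Y f g hf hg hfg hX m hY hM
    have hYr : ResdimLE Λ D d Y := by
      cases m with
      | zero =>
        obtain ⟨W, hW, e⟩ := hY
        exact ⟨0, Nat.zero_le _, W, hωD hW, e⟩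
      | succ m =>
        obtain ⟨W, hW, K, f', g', hf', hg', hfg', hK⟩ := hY
        refine ih Y W K f' g' hf' hg' hfg' (hωD hW) m hK fun W' hW' j hj => ?_
        exact ext_left f g hf hg hfg W' j (hωinj j (by omega) X hX W' hW')
          (hM W' hW' (j + 1) (by omega))
    obtain ⟨n, hn, hr⟩ := hYr
    exact ⟨n + 1, by omega, X, hX, Y, f, g, hf, hg, hfg, hr⟩

end

end SyzAux

theorem resdim_syzygy_le_id_of_relative_cogenerator
    {R : Type u} [CommRing R] [IsArtinianRing R]
    {Λ : Type u} [Ring Λ] [Algebra R Λ] [Module.Finite R Λ]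
    (D ω : Set (ModuleCat.{u} Λ))
    (hDfin : ∀ X ∈ D, Module.Finite Λ X)
    (hDext : ∀ (A B C : ModuleCat.{u} Λ) (f : A →ₗ[Λ] B) (g : B →ₗ[Λ] C),
      Module.Finite Λ B → Function.Injective f → Function.Surjective g →
      Function.Exact f g → A ∈ D → C ∈ D → B ∈ D)
    (hDsum : ∀ B ∈ D, ∀ (M N : ModuleCat.{u} Λ),
      Nonempty ((B : Type u) ≃ₗ[Λ] (↥M × ↥N)) → M ∈ D)
    (hωsum : ∀ B ∈ ω, ∀ (M N : ModuleCat.{u} Λ),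
      Nonempty ((B : Type u) ≃ₗ[Λ] (↥M × ↥N)) → M ∈ ω)
    (hωD : ω ⊆ D)
    (hωinj : ∀ i : ℕ, 1 ≤ i → ∀ A ∈ D, ∀ W ∈ ω, Subsingleton (ExtGrp Λ i A W))
    (hωcog : ∀ X ∈ D, ∃ W ∈ ω, ∃ X' ∈ D,
      ∃ (f : (X : Type u) →ₗ[Λ] (W : Type u)) (g : (W : Type u) →ₗ[Λ] (X' : Type u)),
        Function.Injective f ∧ Function.Surjective g ∧ Function.Exact f g)
    (n d : ℕ)
    (hfin : ∀ M : ModuleCat.{u} Λ, Module.Finite Λ M →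
      ∀ K : ModuleCat.{u} Λ, IsSyzygy Λ n K M → ∃ k : ℕ, ResdimLE Λ D k K)
    (hid : ∀ W ∈ ω, ∀ (M : ModuleCat.{u} Λ) (j : ℕ), d < j →
      Subsingleton (ExtGrp Λ j M W)) :
    ∀ M : ModuleCat.{u} Λ, Module.Finite Λ M →
      ∀ K : ModuleCat.{u} Λ, IsSyzygy Λ n K M → ResdimLE Λ D d K := by
  intro M hM K hK
  obtain ⟨k, m, -, hm⟩ := hfin M hM K hK
  cases m with
  | zero => exact ⟨0, Nat.zero_le _, hm⟩
  | succ m =>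
    obtain ⟨Y, X, f, g, hf, hg, hfg, hX, hY⟩ :=
      (SyzAux.approx hDfin hDext hDsum hωcog (m + 1) K hm).2 m rfl
    exact SyzAux.reduce hDsum hωsum hωD
      (fun i hi A hA W hW => SyzAux.ext_subsingleton i hi A W (hωinj i hi A hA W hW))
      d K X Y f g hf hg hfg hX m hY
      (fun W hW j hj => SyzAux.ext_subsingleton j (by omega) K W (hid W hW K j hj))
end

section
/- Let Λ be an Artin algebra, D a class of finitely generated left Λ-modules closed under extensions and direct summands, and ω a class closed under direct summands which is a D-injective relative cogenerator in D. Fix n, k ∈ ℕ and assume that every n-th syzygy of every finitely generated left Λ-module has D-resolution dimension at most k. Then Ext^j_Λ(M, W) = 0 for every finitely generated left Λ-module M, every W ∈ ω and every j > n + k; consequently every W ∈ ω has injective dimension at most n + k as a Λ-module. -/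
universe u

open CategoryTheory

/-!
Lemma 4.3 of the paper (the inequality `id(ω) ≤ resdim_D(Ω^n(mod Λ)) + n`):
`Λ` is an Artin algebra, `D` a class of finitely generated left `Λ`-modules closed
under extensions and direct summands, `ω` a class closed under direct summands which
is a `D`-injective relative cogenerator in `D`. If every `n`-th syzygy of every
finitely generated module has `D`-resolution dimension at most `k`, then
`Ext^j_Λ(M, W) = 0` for every finitely generated `M`, every `W ∈ ω` and every
`j > n + k`; consequently every `W ∈ ω` has injective dimension at most `n + k`
(i.e. `Ext^j_Λ(M, W) = 0` for all modules `M` and all `j > n + k`).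
-/

open CategoryTheory.Abelian Limits in
theorem aux_bridge {Λ : Type u} [Ring Λ] (M N : ModuleCat.{u} Λ) (i : ℕ) :
    Subsingleton (ExtGrp Λ (i + 1) M N) ↔ Subsingleton (Abelian.Ext.{u} M N (i + 1)) := by
  let P : ProjectiveResolution M := projectiveResolution M
  have h1 : Subsingleton (ExtGrp Λ (i + 1) M N) ↔
      ∀ f : P.complex.X (i + 1) ⟶ N, P.complex.d (i + 2) (i + 1) ≫ f = 0 →
        ∃ g : P.complex.X i ⟶ N, P.complex.d (i + 1) i ≫ g = f := by
    rw [← ModuleCat.isZero_iff_subsingleton, (P.isoExt (R := ℤ) (i + 1) N).isZero_iff,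
      ← HomologicalComplex.exactAt_iff_isZero_homology,
      HomologicalComplex.exactAt_iff' _ i (i + 1) (i + 2) (by simp) (by simp),
      ShortComplex.moduleCat_exact_iff]
    rfl
  rw [h1]
  constructor
  · intro h
    refine subsingleton_of_forall_eq 0 fun α => ?_
    obtain ⟨f, hf, rfl⟩ := P.extMk_surjective α (i + 2) rfl
    rw [P.extMk_eq_zero_iff f (i + 2) rfl hf i rfl]
    exact h f hf
  · intro h f hf
    rw [← P.extMk_eq_zero_iff f (i + 2) rfl hf i rfl]
    exact Subsingleton.elim _ _

theorem aux_bridge' {Λ : Type u} [Ring Λ] (M N : ModuleCat.{u} Λ) (i : ℕ) (hi : 1 ≤ i) :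
    Subsingleton (ExtGrp Λ i M N) ↔ Subsingleton (Abelian.Ext.{u} M N i) := by
  obtain ⟨i, rfl⟩ := Nat.exists_eq_add_of_le' hi
  exact aux_bridge M N i

/-- The short exact sequence attached to an exact pair of linear maps. -/
theorem aux_ses {Λ : Type u} [Ring Λ] {K X M : ModuleCat.{u} Λ} (f : K →ₗ[Λ] X) (g : X →ₗ[Λ] M)
    (hf : Function.Injective f) (hg : Function.Surjective g) (h : Function.Exact f g) :
    (ModuleCat.shortComplexOfCompEqZero f g h.linearMap_comp_eq_zero).ShortExact :=
  ModuleCat.shortComplex_shortExact _ h hf hg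

theorem aux_shift {Λ : Type u} [Ring Λ] {K X M : ModuleCat.{u} Λ} (f : K →ₗ[Λ] X) (g : X →ₗ[Λ] M)
    (hf : Function.Injective f) (hg : Function.Surjective g) (h : Function.Exact f g)
    (W : ModuleCat.{u} Λ) (j : ℕ) (hK : Subsingleton (Abelian.Ext.{u} K W j))
    (hX : Subsingleton (Abelian.Ext.{u} X W (j + 1))) :
    Subsingleton (Abelian.Ext.{u} M W (j + 1)) := by
  have hS := aux_ses f g hf hg h
  refine subsingleton_of_forall_eq 0 fun α => ?_
  obtain ⟨β, hβ⟩ := Abelian.Ext.contravariant_sequence_exact₃ hS W α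
    (@Subsingleton.elim _ hX _ _) (add_comm 1 j)
  have : β = 0 := @Subsingleton.elim _ hK _ _
  rw [← hβ, this, Abelian.Ext.comp_zero]

theorem aux_iso {Λ : Type u} [Ring Λ] {K M : ModuleCat.{u} Λ} (e : K ≃ₗ[Λ] M)
    (W : ModuleCat.{u} Λ) (j : ℕ) (hK : Subsingleton (Abelian.Ext.{u} K W j)) :
    Subsingleton (Abelian.Ext.{u} M W j) := by
  refine subsingleton_of_forall_eq 0 fun α => ?_
  obtain ⟨e'⟩ : Nonempty (K ≅ M) := ⟨e.toModuleIso⟩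
  have h0 : (Abelian.Ext.mk₀ e'.hom).comp α (zero_add j) = 0 :=
    @Subsingleton.elim _ hK _ _
  have := congrArg (fun β => (Abelian.Ext.mk₀ e'.inv).comp β (zero_add j)) h0
  simpa using this

theorem aux_res {Λ : Type u} [Ring Λ] (D : Set (ModuleCat.{u} Λ)) (W : ModuleCat.{u} Λ)
    (hW : ∀ i : ℕ, 1 ≤ i → ∀ A ∈ D, Subsingleton (Abelian.Ext.{u} A W i)) (m : ℕ) :
    ∀ M : ModuleCat.{u} Λ, ResolutionOfLength Λ D m M → ∀ j, m < j →
      Subsingleton (Abelian.Ext.{u} M W j) := by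
  induction m with
  | zero =>
    rintro M ⟨X, hX, ⟨e⟩⟩ j hj
    exact aux_iso e W j (hW j hj X hX)
  | succ m ih =>
    rintro M ⟨X, hX, K, f, g, hf, hg, h, hK⟩ j hj
    obtain ⟨j, rfl⟩ := Nat.exists_eq_add_of_le' (show 1 ≤ j by omega)
    exact aux_shift f g hf hg h W j (ih K hK j (by omega)) (hW _ (by omega) X hX)

theorem aux_syz {Λ : Type u} [Ring Λ] (W K : ModuleCat.{u} Λ) (c : ℕ)
    (hK : ∀ j, c < j → Subsingleton (Abelian.Ext.{u} K W j)) (m : ℕ) :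
    ∀ M : ModuleCat.{u} Λ, IsSyzygy Λ m K M → ∀ j, m + c < j →
      Subsingleton (Abelian.Ext.{u} M W j) := by
  induction m with
  | zero =>
    rintro M ⟨e⟩ j hj
    exact aux_iso e W j (hK j (by omega))
  | succ m ih =>
    rintro M ⟨P, _, hP, K₁, f, g, hf, hg, h, hs⟩ j hj
    obtain ⟨j, rfl⟩ := Nat.exists_eq_add_of_le' (show 1 ≤ j by omega)
    have : Projective P := (IsProjective.iff_projective P).mp hP
    exact aux_shift f g hf hg h W j (ih K₁ hs j (by omega))
      (subsingleton_of_forall_eq 0 fun α => Abelian.Ext.eq_zero_of_projective α)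

theorem aux_exists_syz {Λ : Type u} [Ring Λ] [IsNoetherianRing Λ] (m : ℕ) :
    ∀ M : ModuleCat.{u} Λ, Module.Finite Λ M → ∃ K, IsSyzygy Λ m K M := by
  induction m with
  | zero => exact fun M _ => ⟨M, ⟨LinearEquiv.refl _ _⟩⟩
  | succ m ih =>
    intro M hM
    obtain ⟨r, g, hg⟩ := Module.Finite.exists_fin' Λ M
    obtain ⟨K, hK⟩ := ih (ModuleCat.of Λ (LinearMap.ker g)) inferInstance
    exact ⟨K, ModuleCat.of Λ (Fin r → Λ), inferInstance, inferInstance,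
      ModuleCat.of Λ (LinearMap.ker g), (LinearMap.ker g).subtype, g,
      Subtype.val_injective, hg, LinearMap.exact_subtype_ker_map g, hK⟩

theorem aux_inj {Λ : Type u} [Ring Λ] (d : ℕ) :
    ∀ W : ModuleCat.{u} Λ, (∀ M : ModuleCat.{u} Λ, Module.Finite Λ M → ∀ j, d < j →
      Subsingleton (Abelian.Ext.{u} M W j)) → HasInjectiveDimensionLE W d := by
  induction d with
  | zero =>
    intro W hW
    simp only [HasInjectiveDimensionLE, zero_add, ← injective_iff_hasInjectiveDimensionLT_one,
      ← Module.injective_iff_injective_object Λ W, ← Module.Baer.iff_injective]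
    intro I g
    have hS := aux_ses (K := ModuleCat.of Λ I) (X := ModuleCat.of Λ Λ)
      (M := ModuleCat.of Λ (Λ ⧸ I)) I.subtype I.mkQ Subtype.val_injective
      (Submodule.mkQ_surjective _) (LinearMap.exact_subtype_mkQ I)
    obtain ⟨φ, hφ⟩ := Abelian.Ext.contravariant_sequence_exact₁ hS W
      (Abelian.Ext.mk₀ (ModuleCat.ofHom g)) (add_zero 1)
      (@Subsingleton.elim _ (hW (ModuleCat.of Λ (Λ ⧸ I)) inferInstance 1 (by simp)) _ _)
    obtain ⟨φ, rfl⟩ := Abelian.Ext.homEquiv₀.symm.surjective φ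
    have h2 : ModuleCat.ofHom I.subtype ≫ φ = ModuleCat.ofHom g :=
      Abelian.Ext.homEquiv₀.symm.injective (by simpa using hφ)
    refine ⟨φ.hom, fun x hx => ?_⟩
    exact congrArg (fun k => k.hom ⟨x, hx⟩) h2
  | succ d ih =>
    intro W hW
    let ⟨I, _, f, _⟩ := EnoughInjectives.presentation W
    have hf : Function.Injective f.hom := (ModuleCat.mono_iff_injective f).mp ‹_›
    have hS := aux_ses (M := ModuleCat.of Λ (I ⧸ f.hom.range)) f.hom f.hom.range.mkQ hf
      (Submodule.mkQ_surjective _) f.hom.exact_map_mkQ_range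
    refine (hS.hasInjectiveDimensionLT_X₃_iff d ‹_›).mp (ih _ fun M hM j hj => ?_)
    refine subsingleton_of_forall_eq 0 fun α => ?_
    obtain ⟨β, hβ⟩ := Abelian.Ext.covariant_sequence_exact₃ M hS α rfl
      (@Subsingleton.elim _ (hW M hM (j + 1) (by omega)) _ _)
    obtain ⟨j, rfl⟩ := Nat.exists_eq_add_of_le' (show 1 ≤ j by omega)
    have : β = 0 := Abelian.Ext.eq_zero_of_injective (I := I) β
    rw [← hβ, this, Abelian.Ext.zero_comp]

theorem id_le_resdim_syzygy_add_of_relative_cogenerator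
    {R : Type u} [CommRing R] [IsArtinianRing R]
    {Λ : Type u} [Ring Λ] [Algebra R Λ] [Module.Finite R Λ]
    (D ω : Set (ModuleCat.{u} Λ))
    (hDfin : ∀ X ∈ D, Module.Finite Λ X)
    (hDext : ∀ (A B C : ModuleCat.{u} Λ) (f : A →ₗ[Λ] B) (g : B →ₗ[Λ] C),
      Module.Finite Λ B → Function.Injective f → Function.Surjective g →
      Function.Exact f g → A ∈ D → C ∈ D → B ∈ D)
    (hDsum : ∀ B ∈ D, ∀ (M N : ModuleCat.{u} Λ),
      Nonempty ((B : Type u) ≃ₗ[Λ] (↥M × ↥N)) → M ∈ D)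
    (hωsum : ∀ B ∈ ω, ∀ (M N : ModuleCat.{u} Λ),
      Nonempty ((B : Type u) ≃ₗ[Λ] (↥M × ↥N)) → M ∈ ω)
    (hωD : ω ⊆ D)
    (hωinj : ∀ i : ℕ, 1 ≤ i → ∀ A ∈ D, ∀ W ∈ ω, Subsingleton (ExtGrp Λ i A W))
    (hωcog : ∀ X ∈ D, ∃ W ∈ ω, ∃ X' ∈ D,
      ∃ (f : (X : Type u) →ₗ[Λ] (W : Type u)) (g : (W : Type u) →ₗ[Λ] (X' : Type u)),
        Function.Injective f ∧ Function.Surjective g ∧ Function.Exact f g)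
    (n k : ℕ)
    (hres : ∀ M : ModuleCat.{u} Λ, Module.Finite Λ M →
      ∀ K : ModuleCat.{u} Λ, IsSyzygy Λ n K M → ResdimLE Λ D k K) :
    (∀ M : ModuleCat.{u} Λ, Module.Finite Λ M → ∀ W ∈ ω, ∀ j : ℕ, n + k < j →
      Subsingleton (ExtGrp Λ j M W)) ∧
    (∀ M : ModuleCat.{u} Λ, ∀ W ∈ ω, ∀ j : ℕ, n + k < j →
      Subsingleton (ExtGrp Λ j M W)) := by
  have : IsNoetherian R Λ := inferInstance
  have : IsNoetherianRing Λ := isNoetherian_of_tower R this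
  have key : ∀ M : ModuleCat.{u} Λ, Module.Finite Λ M → ∀ W ∈ ω, ∀ j : ℕ, n + k < j →
      Subsingleton (Abelian.Ext.{u} M W j) := by
    intro M hM W hW
    obtain ⟨K, hK⟩ := aux_exists_syz n M hM
    obtain ⟨m, hm, hr⟩ := hres M hM K hK
    refine aux_syz W K k (fun j hj => ?_) n M hK
    exact aux_res D W (fun i hi A hA => (aux_bridge' A W i hi).mp (hωinj i hi A hA W hW)) m K hr j
      (by omega)
  have key2 : ∀ M : ModuleCat.{u} Λ, ∀ W ∈ ω, ∀ j : ℕ, n + k < j →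
      Subsingleton (ExtGrp Λ j M W) := by
    intro M W hW j hj
    have := aux_inj (n + k) W (fun M hM => key M hM W hW)
    exact (aux_bridge' M W j (by omega)).mpr
      (HasInjectiveDimensionLT.subsingleton W (n + k + 1) j hj M)
  exact ⟨fun M _ => key2 M, key2⟩
end

section
/- Let Λ be an Artin algebra and T a cotilting finitely generated left Λ-module. Then the pair (⊥T, (add T)^∧) is a hereditary complete cotorsion pair in mod(Λ). Explicitly: Ext^1_Λ(X, Y) = 0 for all X ∈ ⊥T and Y ∈ (add T)^∧; a finitely generated module X with Ext^1_Λ(X, Y) = 0 for all Y ∈ (add T)^∧ belongs to ⊥T; a finitely generated module Y with Ext^1_Λ(X, Y) = 0 for all X ∈ ⊥T belongs to (add T)^∧; every M ∈ mod(Λ) admits exact sequences 0 → Y′ → X′ → M → 0 and 0 → M → Y → X → 0 with X, X′ ∈ ⊥T and Y, Y′ ∈ (add T)^∧; moreover ⊥T is resolving and (add T)^∧ is coresolving. -/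
universe u

open CategoryTheory

/-- `AddClass Λ T` is `add T`, the class of direct summands of finite direct sums of
copies of `T`. -/
def AddClass (Λ : Type u) [Ring Λ] (T : ModuleCat.{u} Λ) : Set (ModuleCat.{u} Λ) :=
  {M | ∃ (N : ModuleCat.{u} Λ) (r : ℕ),
    Nonempty ((↥M × ↥N) ≃ₗ[Λ] (Fin r → (T : Type u)))}

/-- `Perp Λ T` is `⊥T`, the class of finitely generated modules `M` with
`Ext^i_Λ(M, T) = 0` for all `i ≥ 1`. -/
def Perp (Λ : Type u) [Ring Λ] (T : ModuleCat.{u} Λ) : Set (ModuleCat.{u} Λ) :=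
  {M | Module.Finite Λ M ∧ ∀ i : ℕ, 1 ≤ i → Subsingleton (ExtGrp Λ i M T)}

/-- `AddWedge Λ T` is `(add T)^∧`, the class of finitely generated modules of finite
`add T`-resolution dimension. -/
def AddWedge (Λ : Type u) [Ring Λ] (T : ModuleCat.{u} Λ) : Set (ModuleCat.{u} Λ) :=
  {M | Module.Finite Λ M ∧ ∃ k : ℕ, ResdimLE Λ (AddClass Λ T) k M}

/-- `T` is a cotilting module: it is finitely generated, has finite injective
dimension, `Ext^i_Λ(T, T) = 0` for all `i ≥ 1`, and every finitely generated
injective module has finite `add T`-resolution dimension. -/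
def IsCotilting (Λ : Type u) [Ring Λ] (T : ModuleCat.{u} Λ) : Prop :=
  Module.Finite Λ T ∧
  (∃ d : ℕ, ∀ (M : ModuleCat.{u} Λ) (j : ℕ), d < j → Subsingleton (ExtGrp Λ j M T)) ∧
  (∀ i : ℕ, 1 ≤ i → Subsingleton (ExtGrp Λ i T T)) ∧
  (∀ I : ModuleCat.{u} Λ, Module.Finite Λ I → Module.Injective Λ I →
    ∃ k : ℕ, ResdimLE Λ (AddClass Λ T) k I)



namespace CotiltAux

/-- Vanishing of the derived-category Ext group. -/
def Van {Λ : Type u} [Ring Λ] (i : ℕ) (M N : ModuleCat.{u} Λ) : Prop :=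
  Subsingleton (Abelian.Ext.{u} M N i)

variable {Λ : Type u} [Ring Λ]

lemma bridge (n : ℕ) (M N : ModuleCat.{u} Λ) :
    Subsingleton (ExtGrp Λ (n + 1) M N) ↔ Van (n + 1) M N := by
  let P := projectiveResolution M
  have h1 : Subsingleton (ExtGrp Λ (n + 1) M N) ↔
      ∀ φ : P.complex.X (n + 1) ⟶ N, P.complex.d (n + 2) (n + 1) ≫ φ = 0 →
        ∃ g : P.complex.X n ⟶ N, P.complex.d (n + 1) n ≫ g = φ := by
    rw [← ModuleCat.isZero_iff_subsingleton, (P.isoExt (R := ℤ) (n + 1) N).isZero_iff,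
      ← HomologicalComplex.exactAt_iff_isZero_homology,
      HomologicalComplex.exactAt_iff' _ n (n + 1) (n + 2) (by simp) (by simp),
      ShortComplex.moduleCat_exact_iff]
    exact Iff.rfl
  rw [h1]
  constructor
  · intro h
    refine ⟨fun a b => ?_⟩
    have key : ∀ a : Abelian.Ext.{u} M N (n + 1), a = 0 := by
      intro a
      obtain ⟨f, hf, rfl⟩ := P.extMk_surjective a (n + 2) rfl
      rw [P.extMk_eq_zero_iff f (n + 2) rfl hf n rfl]
      exact h f hf
    rw [key a, key b]
  · intro h φ hφ
    rw [← P.extMk_eq_zero_iff φ (n + 2) rfl hφ n rfl]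
    exact h.elim _ _

lemma bridge' {i : ℕ} (hi : 1 ≤ i) (M N : ModuleCat.{u} Λ) :
    Subsingleton (ExtGrp Λ i M N) ↔ Van i M N := by
  obtain ⟨n, rfl⟩ := Nat.exists_eq_add_of_le' hi
  exact bridge n M N

lemma van_iff {i : ℕ} {M N : ModuleCat.{u} Λ} :
    Van i M N ↔ ∀ a : Abelian.Ext.{u} M N i, a = 0 :=
  ⟨fun h a => h.elim _ _, fun h => ⟨fun a b => by rw [h a, h b]⟩⟩

/-- A short exact sequence of modules. -/
structure SES {A B C : ModuleCat.{u} Λ} (f : A →ₗ[Λ] B) (g : B →ₗ[Λ] C) : Prop where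
  inj : Function.Injective f
  surj : Function.Surjective g
  exact : Function.Exact f g

section les
variable {A B C : ModuleCat.{u} Λ} {f : A →ₗ[Λ] B} {g : B →ₗ[Λ] C}

lemma SES.zero (h : SES f g) : ModuleCat.ofHom f ≫ ModuleCat.ofHom g = 0 := by
  ext x
  exact h.exact.apply_apply_eq_zero x

lemma SES.short (h : SES f g) :
    (ShortComplex.mk (ModuleCat.ofHom f) (ModuleCat.ofHom g) h.zero).ShortExact where
  exact := by
    rw [ShortComplex.ShortExact.moduleCat_exact_iff_function_exact]
    exact h.exact
  mono_f := (ModuleCat.mono_iff_injective _).2 h.inj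
  epi_g := (ModuleCat.epi_iff_surjective _).2 h.surj

open Abelian

lemma SES.contra_mid (h : SES f g) {i : ℕ} {N : ModuleCat.{u} Λ}
    (hA : Van i A N) (hC : Van i C N) : Van i B N := by
  rw [van_iff] at *
  intro a
  obtain ⟨b, rfl⟩ := Ext.contravariant_sequence_exact₂ h.short N a (hA _)
  rw [hC b, Ext.comp_zero]

lemma SES.contra_right (h : SES f g) {i : ℕ} {N : ModuleCat.{u} Λ}
    (hA : Van i A N) (hB : Van (i + 1) B N) : Van (i + 1) C N := by
  rw [van_iff] at *
  intro a
  obtain ⟨b, rfl⟩ := Ext.contravariant_sequence_exact₃ h.short N a (hB _) (add_comm 1 i)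
  rw [hA b, Ext.comp_zero]

lemma SES.contra_left (h : SES f g) {i : ℕ} {N : ModuleCat.{u} Λ}
    (hB : Van i B N) (hC : Van (i + 1) C N) : Van i A N := by
  rw [van_iff] at *
  intro a
  obtain ⟨b, rfl⟩ := Ext.contravariant_sequence_exact₁ h.short N a (add_comm 1 i) (hC _)
  rw [hB b, Ext.comp_zero]

lemma SES.contra_hom (h : SES f g) {N : ModuleCat.{u} Λ}
    (hA : ∀ φ : A →ₗ[Λ] N, ∃ ψ : B →ₗ[Λ] N, ψ ∘ₗ f = φ) (hB : Van 1 B N) : Van 1 C N := by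
  rw [van_iff] at *
  intro a
  obtain ⟨b, rfl⟩ := Ext.contravariant_sequence_exact₃ h.short N a (hB _) (add_comm 1 0)
  obtain ⟨φ, rfl⟩ := Ext.homEquiv₀.symm.surjective b
  obtain ⟨ψ, hψ⟩ := hA φ.hom
  have : φ = ModuleCat.ofHom f ≫ ModuleCat.ofHom ψ := by
    ext x
    exact (congrArg (fun l : A →ₗ[Λ] N => l x) hψ).symm
  rw [this]
  have e : Ext.homEquiv₀.symm (ModuleCat.ofHom f ≫ ModuleCat.ofHom ψ) =
    (Ext.mk₀ (ModuleCat.ofHom f)).comp (Ext.mk₀ (ModuleCat.ofHom ψ)) (add_zero 0) := by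
    rw [Ext.mk₀_comp_mk₀]; rfl
  rw [e]
  exact h.short.extClass_comp_assoc _ 

lemma SES.contra_ext (h : SES f g) {N : ModuleCat.{u} Λ} (hC : Van 1 C N)
    (φ : A →ₗ[Λ] N) : ∃ ψ : B →ₗ[Λ] N, ψ ∘ₗ f = φ := by
  rw [van_iff] at hC
  obtain ⟨b, hb⟩ := Ext.contravariant_sequence_exact₁ h.short N
    (Ext.mk₀ (ModuleCat.ofHom φ)) (add_comm 1 0) (hC _)
  obtain ⟨ψ, rfl⟩ := Ext.homEquiv₀.symm.surjective b
  refine ⟨ψ.hom, ?_⟩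
  have e : Ext.mk₀ (ModuleCat.ofHom f ≫ ψ) = Ext.mk₀ (ModuleCat.ofHom φ) := by
    rw [← hb, ← Ext.mk₀_comp_mk₀]; rfl
  have e2 := Ext.mk₀_bijective _ _ |>.1 e
  exact congrArg ModuleCat.Hom.hom e2

lemma SES.co_mid (h : SES f g) {i : ℕ} {X : ModuleCat.{u} Λ}
    (hA : Van i X A) (hC : Van i X C) : Van i X B := by
  rw [van_iff] at *
  intro a
  obtain ⟨b, rfl⟩ := Ext.covariant_sequence_exact₂ X h.short a (hC _)
  rw [hA b, Ext.zero_comp]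

lemma SES.co_left (h : SES f g) {i : ℕ} {X : ModuleCat.{u} Λ}
    (hC : Van i X C) (hB : Van (i + 1) X B) : Van (i + 1) X A := by
  rw [van_iff] at *
  intro a
  obtain ⟨b, rfl⟩ := Ext.covariant_sequence_exact₁ X h.short a (hB _) rfl
  rw [hC b, Ext.zero_comp]

lemma SES.co_right (h : SES f g) {i : ℕ} {X : ModuleCat.{u} Λ}
    (hB : Van i X B) (hA : Van (i + 1) X A) : Van i X C := by
  rw [van_iff] at *
  intro a
  obtain ⟨b, rfl⟩ := Ext.covariant_sequence_exact₃ X h.short a rfl (hA _)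
  rw [hB b, Ext.zero_comp]

lemma SES.co_lift (h : SES f g) {X : ModuleCat.{u} Λ} (hA : Van 1 X A)
    (φ : X →ₗ[Λ] C) : ∃ ψ : X →ₗ[Λ] B, g ∘ₗ ψ = φ := by
  rw [van_iff] at hA
  obtain ⟨b, hb⟩ := Ext.covariant_sequence_exact₃ X h.short
    (Ext.mk₀ (ModuleCat.ofHom φ)) (zero_add 1) (hA _)
  obtain ⟨ψ, rfl⟩ := Ext.homEquiv₀.symm.surjective b
  refine ⟨ψ.hom, ?_⟩
  have e : Ext.mk₀ (ψ ≫ ModuleCat.ofHom g) = Ext.mk₀ (ModuleCat.ofHom φ) := by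
    rw [← hb, ← Ext.mk₀_comp_mk₀]; rfl
  have e2 := Ext.mk₀_bijective _ _ |>.1 e
  exact congrArg ModuleCat.Hom.hom e2

lemma van_proj (P N : ModuleCat.{u} Λ) [Module.Projective Λ P] (i : ℕ) : Van (i + 1) P N := by
  have : Projective P := (IsProjective.iff_projective P).1 inferInstance
  exact Ext.subsingleton_of_projective P N i

lemma van_inj (M I : ModuleCat.{u} Λ) (hI : Module.Injective Λ I) (i : ℕ) : Van (i + 1) M I := by
  have : Injective I := (Module.injective_iff_injective_object Λ I).1 hI
  exact Ext.subsingleton_of_injective M I i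

/-- Covariant retracts. -/
lemma van_retract_right {X M N : ModuleCat.{u} Λ} {i : ℕ} (s : M →ₗ[Λ] N) (p : N →ₗ[Λ] M)
    (hps : p ∘ₗ s = LinearMap.id) (h : Van i X N) : Van i X M := by
  rw [van_iff] at *
  intro a
  have e : ModuleCat.ofHom s ≫ ModuleCat.ofHom p = 𝟙 M := by
    rw [← ModuleCat.ofHom_comp, hps]; rfl
  have : (a.comp (Ext.mk₀ (ModuleCat.ofHom s)) (add_zero i)).comp
      (Ext.mk₀ (ModuleCat.ofHom p)) (add_zero i) = a := by
    rw [Ext.comp_assoc_of_third_deg_zero, Ext.mk₀_comp_mk₀, e, Ext.comp_mk₀_id]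
  rw [← this, h (a.comp _ _), Ext.zero_comp]

lemma van_retract_left {X M N : ModuleCat.{u} Λ} {i : ℕ} (s : M →ₗ[Λ] N) (p : N →ₗ[Λ] M)
    (hps : p ∘ₗ s = LinearMap.id) (h : Van i N X) : Van i M X := by
  rw [van_iff] at *
  intro a
  have e : ModuleCat.ofHom s ≫ ModuleCat.ofHom p = 𝟙 M := by
    rw [← ModuleCat.ofHom_comp, hps]; rfl
  have : (Ext.mk₀ (ModuleCat.ofHom s)).comp ((Ext.mk₀ (ModuleCat.ofHom p)).comp a (zero_add i))
      (zero_add i) = a := by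
    rw [Ext.mk₀_comp_mk₀_assoc, e, Ext.mk₀_id_comp]
  rw [← this, h (Ext.comp _ a _), Ext.comp_zero]

end les


section hull

/-- Elementwise essential extension of submodules. -/
def Ess {Q : Type u} [AddCommGroup Q] [Module Λ Q] (M P : Submodule Λ Q) : Prop :=
  M ≤ P ∧ ∀ x ∈ P, x ≠ 0 → ∃ r : Λ, r • x ∈ M ∧ r • x ≠ 0

lemma exists_max_ess {Q : Type u} [AddCommGroup Q] [Module Λ Q] (M : Submodule Λ Q) :
    ∃ N : Submodule Λ Q, Ess M N ∧ ∀ P, Ess M P → N ≤ P → P ≤ N := by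
  have hM : Ess M M := ⟨le_rfl, fun x hx h0 => ⟨1, by simpa using hx, by simpa using h0⟩⟩
  obtain ⟨N, hMN, hN⟩ := zorn_le_nonempty₀ {P : Submodule Λ Q | Ess M P} (by
    intro c hc hchain y hy
    refine ⟨sSup c, ⟨(hc hy).1.trans (le_sSup hy), ?_⟩, fun z hz => le_sSup hz⟩
    intro x hx h0
    rw [Submodule.mem_sSup_of_directed ⟨y, hy⟩ hchain.directedOn] at hx
    obtain ⟨P, hP, hxP⟩ := hx
    exact (hc hP).2 x hxP h0) M hM
  exact ⟨N, hN.1, fun P hP hNP => hN.2 hP hNP⟩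

lemma exists_max_disj {Q : Type u} [AddCommGroup Q] [Module Λ Q] (N : Submodule Λ Q) :
    ∃ C : Submodule Λ Q, (∀ x ∈ C, x ∈ N → x = 0) ∧
      ∀ q, q ∉ C → ∃ r : Λ, ∃ c ∈ C, c + r • q ∈ N ∧ c + r • q ≠ 0 := by
  obtain ⟨C, -, hC⟩ := zorn_le_nonempty₀ {C : Submodule Λ Q | ∀ x ∈ C, x ∈ N → x = 0} (by
    intro c hc hchain y hy
    refine ⟨sSup c, ?_, fun z hz => le_sSup hz⟩
    intro x hx h0
    rw [Submodule.mem_sSup_of_directed ⟨y, hy⟩ hchain.directedOn] at hx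
    obtain ⟨P, hP, hxP⟩ := hx
    exact hc hP x hxP h0) ⊥ (by intro x hx _; simpa using hx)
  refine ⟨C, hC.1, fun q hq => ?_⟩
  by_contra hcon
  push Not at hcon
  apply hq
  have : C ⊔ Submodule.span Λ {q} ≤ C := by
    refine hC.2 ?_ le_sup_left
    intro x hx hxN
    obtain ⟨c, hc, z, hz, rfl⟩ := Submodule.mem_sup.1 hx
    obtain ⟨r, rfl⟩ := Submodule.mem_span_singleton.1 hz
    exact hcon r c hc hxN
  exact this (Submodule.mem_sup_right (Submodule.mem_span_singleton_self q))

lemma exists_hull {Q : Type u} [AddCommGroup Q] [Module Λ Q] (hQ : Module.Injective Λ Q)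
    (M : Submodule Λ Q) : ∃ N : Submodule Λ Q, Ess M N ∧ Module.Injective Λ N := by
  obtain ⟨N, hN, hmax⟩ := exists_max_ess M
  obtain ⟨C, hC, hCmax⟩ := exists_max_disj N
  refine ⟨N, hN, ?_⟩
  have hinj : Function.Injective (C.mkQ ∘ₗ N.subtype) := by
    rw [injective_iff_map_eq_zero]
    intro a ha
    have : (a : Q) ∈ C := by simpa using ha
    exact Subtype.ext (hC _ this a.2)
  obtain ⟨h, hh⟩ := hQ.out (C.mkQ ∘ₗ N.subtype) hinj N.subtype
  have hh' : ∀ n ∈ N, h (C.mkQ n) = n := fun n hn => hh ⟨n, hn⟩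
  have hle : LinearMap.range h ≤ N := by
    refine hmax _ ⟨?_, ?_⟩ ?_
    · intro m hm
      exact ⟨C.mkQ m, hh' m (hN.1 hm)⟩
    · rintro _ ⟨z, rfl⟩ h0
      obtain ⟨q, rfl⟩ := C.mkQ_surjective z
      have hq : q ∉ C := by
        intro hq
        apply h0
        rw [(by simpa using hq : C.mkQ q = 0), map_zero]
      obtain ⟨r, c, hc, hn, hn0⟩ := hCmax q hq
      have e : c + r • q = r • h (C.mkQ q) := by
        rw [← hh' _ hn, map_add, (by simpa using hc : C.mkQ c = 0), zero_add, map_smul, map_smul]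
      rw [e] at hn hn0
      obtain ⟨s, hs, hs0⟩ := hN.2 _ hn hn0
      exact ⟨s * r, by rwa [mul_smul], by rwa [mul_smul]⟩
    · intro m hm
      exact ⟨C.mkQ m, hh' m hm⟩
  let p : Q →ₗ[Λ] N := (h ∘ₗ C.mkQ).codRestrict N (fun x => hle ⟨_, rfl⟩)
  constructor
  intro X Y _ _ _ _ f hf g
  obtain ⟨k, hk⟩ := hQ.out f hf (N.subtype ∘ₗ g)
  refine ⟨p ∘ₗ k, fun x => Subtype.ext ?_⟩
  change h (C.mkQ (k (f x))) = _
  rw [hk x]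
  exact hh' _ (g x).2

lemma finite_hom_of_ess {R : Type u} [CommRing R] [IsArtinianRing R] [Algebra R Λ]
    {Q : Type u} [AddCommGroup Q] [Module Λ Q] [Module R Q]
    [IsScalarTower R Λ Q] [SMulCommClass Λ R Q] (M : Submodule Λ Q)
    (hM : Ess M ⊤) [Module.Finite R M] (L : Type u) [AddCommGroup L] [Module Λ L]
    (hL : IsFiniteLength Λ L) : IsNoetherian R (L →ₗ[Λ] Q) := by
  have simp_case : ∀ (L : Type u) [AddCommGroup L] [Module Λ L] [IsSimpleModule Λ L],
      IsNoetherian R (L →ₗ[Λ] Q) := by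
    intro L _ _ _
    have := IsSimpleModule.nontrivial Λ L
    obtain ⟨x, hx⟩ := exists_ne (0 : L)
    have gen : ∀ y : L, y ≠ 0 → ∀ z : L, ∃ r : Λ, r • y = z := by
      intro y hy z
      have := IsSimpleModule.span_singleton_eq_top Λ hy
      exact Submodule.mem_span_singleton.1 (this ▸ Submodule.mem_top)
    have hmem : ∀ φ : L →ₗ[Λ] Q, φ x ∈ M := by
      intro φ
      by_cases h0 : φ x = 0
      · rw [h0]; exact M.zero_mem
      obtain ⟨r, hr, hr0⟩ := hM.2 _ Submodule.mem_top h0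
      have : r • x ≠ 0 := by
        intro h
        rw [← map_smul, h, map_zero] at hr0
        exact hr0 rfl
      obtain ⟨s, hs⟩ := gen _ this x
      rw [← hs, map_smul, map_smul]
      exact M.smul_mem _ hr
    let ev : (L →ₗ[Λ] Q) →ₗ[R] M :=
      { toFun := fun φ => ⟨φ x, hmem φ⟩
        map_add' := fun _ _ => rfl
        map_smul' := fun _ _ => rfl }
    refine isNoetherian_of_injective ev ?_
    intro φ ψ h
    have h' : φ x = ψ x := congrArg Subtype.val h
    ext z
    obtain ⟨r, rfl⟩ := gen x hx z
    rw [map_smul, map_smul, h']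
  induction hL with
  | @of_subsingleton L _ _ _ =>
    have : Subsingleton (L →ₗ[Λ] Q) := ⟨fun a b => by
      ext x; rw [Subsingleton.elim x 0, map_zero, map_zero]⟩
    infer_instance
  | @of_simple_quotient L _ _ S _ _ ih =>
    have := simp_case (L ⧸ S)
    let f : ((L ⧸ S) →ₗ[Λ] Q) →ₗ[R] (L →ₗ[Λ] Q) :=
      { toFun := fun φ => φ ∘ₗ S.mkQ
        map_add' := fun _ _ => rfl
        map_smul' := fun _ _ => rfl }
    let g : (L →ₗ[Λ] Q) →ₗ[R] (S →ₗ[Λ] Q) :=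
      { toFun := fun φ => φ ∘ₗ S.subtype
        map_add' := fun _ _ => rfl
        map_smul' := fun _ _ => rfl }
    refine isNoetherian_of_range_eq_ker f g ?_
    ext φ
    constructor
    · rintro ⟨ψ, rfl⟩
      rw [LinearMap.mem_ker]
      ext x
      change ψ (S.mkQ x) = 0
      rw [(by simp : S.mkQ (x : L) = 0), map_zero]
    · intro h
      rw [LinearMap.mem_ker] at h
      refine ⟨S.liftQ φ ?_, ?_⟩
      · intro x hx
        exact congrArg (fun l : S →ₗ[Λ] Q => l ⟨x, hx⟩) h
      · exact S.liftQ_mkQ φ _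

lemma exists_fg_inj {R : Type u} [CommRing R] [IsArtinianRing R] [Algebra R Λ]
    [Module.Finite R Λ] (M : ModuleCat.{u} Λ) (hM : Module.Finite Λ M) :
    ∃ (I : ModuleCat.{u} Λ) (j : M →ₗ[Λ] I), Module.Finite Λ I ∧ Module.Injective Λ I ∧
      Function.Injective j := by
  let Q : ModuleCat.{u} Λ := Injective.under M
  have hQ : Module.Injective Λ Q := (Module.injective_iff_injective_object Λ Q).2
    (inferInstanceAs (Injective (Injective.under M)))
  let i : M →ₗ[Λ] Q := (Injective.ι M).hom
  have hi : Function.Injective i := (ModuleCat.mono_iff_injective (Injective.ι M)).1 inferInstance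
  obtain ⟨N, hN, hNinj⟩ := exists_hull hQ (LinearMap.range i)
  let : Module R Q := Module.compHom Q (algebraMap R Λ)
  have : IsScalarTower R Λ Q := IsScalarTower.of_algebraMap_smul fun _ _ => rfl
  have : SMulCommClass Λ R Q := IsScalarTower.to_smulCommClass'
  let j : M →ₗ[Λ] N := i.codRestrict N (fun x => hN.1 ⟨x, rfl⟩)
  have hess : Ess (LinearMap.range j) ⊤ := by
    refine ⟨le_top, fun x _ h0 => ?_⟩
    obtain ⟨r, ⟨m, hm⟩, hr0⟩ := hN.2 x x.2 (fun h => h0 (Subtype.ext h))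
    refine ⟨r, ⟨m, Subtype.ext hm⟩, fun h => hr0 (congrArg Subtype.val h)⟩
  have : Module.Finite R (LinearMap.range j) := Module.Finite.trans Λ _
  have : IsNoetherian R Λ := isNoetherian_of_isNoetherianRing_of_finite R Λ
  have : IsArtinian R Λ := inferInstance
  have : IsNoetherian Λ Λ := isNoetherian_of_tower R inferInstance
  have : IsArtinian Λ Λ := isArtinian_of_tower R inferInstance
  have hL : IsFiniteLength Λ Λ := isFiniteLength_iff_isNoetherian_isArtinian.2 ⟨‹_›, ‹_›⟩
  have := finite_hom_of_ess (R := R) (LinearMap.range j) hess Λ hL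
  let ev : (Λ →ₗ[Λ] N) →ₗ[R] N :=
    { toFun := fun φ => φ 1
      map_add' := fun _ _ => rfl
      map_smul' := fun _ _ => rfl }
  have : Module.Finite R N := Module.Finite.of_surjective ev
    (fun x => ⟨LinearMap.toSpanSingleton Λ N x, by simp [ev]⟩)
  refine ⟨ModuleCat.of Λ N, j, Module.Finite.of_restrictScalars_finite R Λ N, hNinj, ?_⟩
  intro a b h
  exact hi (congrArg Subtype.val h)

end hull


section main

variable {T : ModuleCat.{u} Λ}

lemma pow_ses (T : ModuleCat.{u} Λ) (r : ℕ) :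
    SES (A := T) (B := ModuleCat.of Λ (Fin (r + 1) → T)) (C := ModuleCat.of Λ (Fin r → T))
      (LinearMap.single Λ (fun _ : Fin (r + 1) => (T : Type u)) 0)
      (LinearMap.funLeft Λ T Fin.succ) where
  inj := Pi.single_injective (M := fun _ : Fin (r + 1) => (T : Type u)) 0
  surj := LinearMap.funLeft_surjective_of_injective Λ T _ (Fin.succ_injective r)
  exact := by
    intro x
    constructor
    · intro h
      refine ⟨x 0, ?_⟩
      funext j
      refine Fin.cases ?_ (fun k => ?_) j
      · simp
      · have := congrFun h k
        simp only [LinearMap.coe_single]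
        rw [Pi.single_eq_of_ne (Fin.succ_ne_zero k)]
        exact this.symm
    · rintro ⟨y, rfl⟩
      funext k
      simp [LinearMap.funLeft_apply]
      rfl

lemma van_pow_right {X : ModuleCat.{u} Λ} {i : ℕ} (h : Van i X T) (r : ℕ) :
    Van i X (ModuleCat.of Λ (Fin r → T)) := by
  induction r with
  | zero =>
    refine van_retract_right (N := T) 0 0 ?_ h
    refine LinearMap.ext fun x => funext fun j => j.elim0
  | succ r ih => exact (pow_ses T r).co_mid h ih

lemma van_pow_left {X : ModuleCat.{u} Λ} {i : ℕ} (h : Van i T X) (r : ℕ) :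
    Van i (ModuleCat.of Λ (Fin r → T)) X := by
  induction r with
  | zero =>
    refine van_retract_left (N := T) 0 0 ?_ h
    refine LinearMap.ext fun x => funext fun j => j.elim0
  | succ r ih => exact (pow_ses T r).contra_mid h ih

lemma addClass_iff {W : ModuleCat.{u} Λ} : W ∈ AddClass Λ T ↔
    ∃ (r : ℕ) (s : W →ₗ[Λ] (Fin r → T)) (p : (Fin r → T) →ₗ[Λ] W), p ∘ₗ s = LinearMap.id := by
  constructor
  · rintro ⟨N, r, ⟨e⟩⟩
    refine ⟨r, e.toLinearMap ∘ₗ LinearMap.inl Λ W N, LinearMap.fst Λ W N ∘ₗ e.symm.toLinearMap, ?_⟩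
    ext x
    simp
  · rintro ⟨r, s, p, h⟩
    have hps : ∀ x, p (s x) = x := fun x => congrArg (fun l : W →ₗ[Λ] W => l x) h
    refine ⟨ModuleCat.of Λ (LinearMap.ker p), r, ⟨?_⟩⟩
    refine LinearEquiv.ofBijective (s.coprod (LinearMap.ker p).subtype) ⟨?_, ?_⟩
    · rw [injective_iff_map_eq_zero]
      rintro ⟨w, k, hk⟩ h0
      rw [LinearMap.mem_ker] at hk
      have h0' : s w + k = 0 := h0
      have hw : w = 0 := by
        have := congrArg p h0'
        rwa [map_add, hps, hk, add_zero, map_zero] at this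
      subst hw
      rw [map_zero, zero_add] at h0'
      subst h0'
      rfl
    · intro y
      refine ⟨(p y, ⟨y - s (p y), ?_⟩), ?_⟩
      · rw [LinearMap.mem_ker, map_sub, hps, sub_self]
      · change s (p y) + (y - s (p y)) = y
        abel

lemma addClass_pow (T : ModuleCat.{u} Λ) (r : ℕ) :
    ModuleCat.of Λ (Fin r → T) ∈ AddClass Λ T :=
  addClass_iff.2 ⟨r, LinearMap.id, LinearMap.id, rfl⟩

lemma addClass_finite (hT : Module.Finite Λ T) {W : ModuleCat.{u} Λ} (hW : W ∈ AddClass Λ T) :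
    Module.Finite Λ W := by
  obtain ⟨r, s, p, h⟩ := addClass_iff.1 hW
  exact Module.Finite.of_surjective p fun x => ⟨s x, congrArg (fun l : W →ₗ[Λ] W => l x) h⟩

lemma van_add_right {X W : ModuleCat.{u} Λ} {i : ℕ} (h : Van i X T) (hW : W ∈ AddClass Λ T) :
    Van i X W := by
  obtain ⟨r, s, p, hps⟩ := addClass_iff.1 hW
  exact van_retract_right (N := ModuleCat.of Λ (Fin r → T)) s p hps (van_pow_right h r)

lemma van_add_left {X W : ModuleCat.{u} Λ} {i : ℕ} (h : Van i T X) (hW : W ∈ AddClass Λ T) :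
    Van i W X := by
  obtain ⟨r, s, p, hps⟩ := addClass_iff.1 hW
  exact van_retract_left (N := ModuleCat.of Λ (Fin r → T)) s p hps (van_pow_left h r)

lemma van_res {X : ModuleCat.{u} Λ} (hX : ∀ i, Van (i + 1) X T) (n : ℕ) :
    ∀ Y, ResolutionOfLength Λ (AddClass Λ T) n Y → ∀ i, Van (i + 1) X Y := by
  induction n with
  | zero =>
    rintro Y ⟨W, hW, ⟨e⟩⟩ i
    refine van_retract_right (N := W) e.symm.toLinearMap e.toLinearMap ?_ (van_add_right (hX i) hW)
    ext x; simp
  | succ n ih =>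
    rintro Y ⟨W, hW, K, f, g, hf, hg, hfg, hK⟩ i
    exact (SES.mk hf hg hfg).co_right (van_add_right (hX i) hW) (ih K hK (i + 1))

lemma perp_iff {X : ModuleCat.{u} Λ} :
    X ∈ Perp Λ T ↔ Module.Finite Λ X ∧ ∀ i, Van (i + 1) X T := by
  refine and_congr Iff.rfl ⟨fun h i => (bridge i X T).1 (h (i + 1) (by omega)), fun h i hi => ?_⟩
  obtain ⟨n, rfl⟩ := Nat.exists_eq_add_of_le' hi
  exact (bridge n X T).2 (h n)

lemma van_wedge {X Y : ModuleCat.{u} Λ} (hX : X ∈ Perp Λ T) (hY : Y ∈ AddWedge Λ T) (i : ℕ) :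
    Van (i + 1) X Y := by
  obtain ⟨-, k, n, -, h⟩ := hY
  exact van_res (perp_iff.1 hX).2 n Y h i

lemma wedge_of_ses {K W Y : ModuleCat.{u} Λ} {f : K →ₗ[Λ] W} {g : W →ₗ[Λ] Y} (h : SES f g)
    (hY : Module.Finite Λ Y) (hK : K ∈ AddWedge Λ T) (hW : W ∈ AddClass Λ T) :
    Y ∈ AddWedge Λ T := by
  obtain ⟨-, k, n, -, hn⟩ := hK
  exact ⟨hY, n + 1, n + 1, le_rfl, W, hW, K, f, g, h.inj, h.surj, h.exact, hn⟩

lemma wedge_of_add {Y : ModuleCat.{u} Λ} (hT : Module.Finite Λ T) (hY : Y ∈ AddClass Λ T) :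
    Y ∈ AddWedge Λ T :=
  ⟨addClass_finite hT hY, 0, 0, le_rfl, Y, hY, ⟨LinearEquiv.refl Λ Y⟩⟩

lemma pushout_ses {K X M Y Z : ModuleCat.{u} Λ} {f : K →ₗ[Λ] X} {g : X →ₗ[Λ] M}
    {a : K →ₗ[Λ] Y} {b : Y →ₗ[Λ] Z} (h : SES f g) (h' : SES a b)
    (hX : Module.Finite Λ X) (hY : Module.Finite Λ Y) :
    ∃ (P : ModuleCat.{u} Λ) (i : Y →ₗ[Λ] P) (p : P →ₗ[Λ] M) (j : X →ₗ[Λ] P) (q : P →ₗ[Λ] Z),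
      SES i p ∧ SES j q ∧ Module.Finite Λ P := by
  let D : Submodule Λ (X × Y) := LinearMap.range (f.prod (-a))
  have hD : ∀ x y, D.mkQ (x, y) = 0 ↔ ∃ k, f k = x ∧ -a k = y := by
    intro x y
    rw [Submodule.mkQ_apply, Submodule.Quotient.mk_eq_zero]
    constructor
    · rintro ⟨k, hk⟩
      exact ⟨k, congrArg Prod.fst hk, congrArg Prod.snd hk⟩
    · rintro ⟨k, rfl, rfl⟩
      exact ⟨k, rfl⟩
  let p : (X × Y) ⧸ D →ₗ[Λ] M := D.liftQ (g ∘ₗ LinearMap.fst Λ X Y) (by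
    rintro _ ⟨k, rfl⟩
    exact h.exact.apply_apply_eq_zero k)
  let q : (X × Y) ⧸ D →ₗ[Λ] Z := D.liftQ (b ∘ₗ LinearMap.snd Λ X Y) (by
    rintro _ ⟨k, rfl⟩
    change b (-a k) = 0
    rw [map_neg, h'.exact.apply_apply_eq_zero k, neg_zero])
  have hp : ∀ x y, p (D.mkQ (x, y)) = g x := fun _ _ => rfl
  have hq : ∀ x y, q (D.mkQ (x, y)) = b y := fun _ _ => rfl
  refine ⟨ModuleCat.of Λ ((X × Y) ⧸ D), D.mkQ ∘ₗ LinearMap.inr Λ X Y, p,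
    D.mkQ ∘ₗ LinearMap.inl Λ X Y, q, ⟨?_, ?_, ?_⟩, ⟨?_, ?_, ?_⟩, Module.Finite.quotient Λ D⟩
  · rw [injective_iff_map_eq_zero]
    intro y hy
    obtain ⟨k, hk, rfl⟩ := (hD 0 y).1 hy
    rw [h.inj (hk.trans (map_zero f).symm), map_zero, neg_zero]
  · intro m
    obtain ⟨x, rfl⟩ := h.surj m
    exact ⟨D.mkQ (x, 0), rfl⟩
  · intro z
    obtain ⟨⟨x, y⟩, rfl⟩ := D.mkQ_surjective z
    constructor
    · intro hz
      obtain ⟨k, rfl⟩ := (h.exact x).1 hz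
      refine ⟨y + a k, ?_⟩
      change D.mkQ (0, y + a k) = _
      rw [← sub_eq_zero, ← map_sub]
      exact (hD _ _).2 ⟨-k, by simp, by simp⟩
    · rintro ⟨y', hy'⟩
      rw [← hy']
      exact map_zero g
  · rw [injective_iff_map_eq_zero]
    intro x hx
    obtain ⟨k, rfl, hk⟩ := (hD x 0).1 hx
    rw [h'.inj ((neg_eq_zero.1 hk).trans (map_zero a).symm), map_zero]
  · intro m
    obtain ⟨y, rfl⟩ := h'.surj m
    exact ⟨D.mkQ (0, y), rfl⟩
  · intro z
    obtain ⟨⟨x, y⟩, rfl⟩ := D.mkQ_surjective z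
    constructor
    · intro hz
      obtain ⟨k, rfl⟩ := (h'.exact y).1 hz
      refine ⟨x + f k, ?_⟩
      change D.mkQ (x + f k, 0) = _
      rw [← sub_eq_zero, ← map_sub]
      exact (hD _ _).2 ⟨k, by simp, by simp⟩
    · rintro ⟨y', hy'⟩
      rw [← hy']
      exact map_zero b

lemma third_ses {Y Z M W X : ModuleCat.{u} Λ} {i : Y →ₗ[Λ] Z} {p : Z →ₗ[Λ] M}
    {t : Z →ₗ[Λ] W} {q : W →ₗ[Λ] X} (h : SES i p) (h' : SES t q) (hW : Module.Finite Λ W) :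
    ∃ (V : ModuleCat.{u} Λ) (j : Y →ₗ[Λ] W) (c : W →ₗ[Λ] V) (m : M →ₗ[Λ] V) (n : V →ₗ[Λ] X),
      SES j c ∧ SES m n ∧ Module.Finite Λ V := by
  let D : Submodule Λ W := LinearMap.range (t ∘ₗ i)
  have hD : ∀ w, D.mkQ w = 0 ↔ ∃ y, t (i y) = w := by
    intro w
    rw [Submodule.mkQ_apply, Submodule.Quotient.mk_eq_zero]
    exact Iff.rfl
  let n : W ⧸ D →ₗ[Λ] X := D.liftQ q (by
    rintro _ ⟨k, rfl⟩
    exact h'.exact.apply_apply_eq_zero (i k))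
  obtain ⟨m, hm⟩ : ∃ m : M →ₗ[Λ] W ⧸ D, ∀ z, m (p z) = D.mkQ (t z) := by
    have hker : LinearMap.ker p ≤ LinearMap.ker (D.mkQ ∘ₗ t) := by
      intro z hz
      obtain ⟨y, rfl⟩ := (h.exact z).1 hz
      exact (hD _).2 ⟨y, rfl⟩
    refine ⟨(LinearMap.ker p).liftQ (D.mkQ ∘ₗ t) hker ∘ₗ
      (p.quotKerEquivOfSurjective h.surj).symm.toLinearMap, fun z => ?_⟩
    have : (p.quotKerEquivOfSurjective h.surj).symm (p z) = (LinearMap.ker p).mkQ z := by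
      rw [LinearEquiv.symm_apply_eq]; rfl
    rw [LinearMap.comp_apply, LinearEquiv.coe_coe, this]
    rfl
  refine ⟨ModuleCat.of Λ (W ⧸ D), t ∘ₗ i, D.mkQ, m, n, ⟨h'.inj.comp h.inj, D.mkQ_surjective, hD⟩,
    ⟨?_, ?_, ?_⟩, Module.Finite.quotient Λ D⟩
  · rw [injective_iff_map_eq_zero]
    intro x hx
    obtain ⟨z, rfl⟩ := h.surj x
    rw [hm] at hx
    obtain ⟨y, hy⟩ := (hD _).1 hx
    rw [← h'.inj hy, h.exact.apply_apply_eq_zero]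
  · intro x
    obtain ⟨w, rfl⟩ := h'.surj x
    exact ⟨D.mkQ w, rfl⟩
  · intro v
    obtain ⟨w, rfl⟩ := D.mkQ_surjective v
    constructor
    · intro hv
      obtain ⟨z, rfl⟩ := (h'.exact w).1 hv
      exact ⟨p z, hm z⟩
    · rintro ⟨x, hx⟩
      obtain ⟨z, rfl⟩ := h.surj x
      rw [← hx, hm]
      exact h'.exact.apply_apply_eq_zero z

/-- Left `add T`-approximation. -/
lemma exists_approx {R : Type u} [CommRing R] [IsArtinianRing R] [Algebra R Λ]
    [Module.Finite R Λ] (hT : Module.Finite Λ T) (X : ModuleCat.{u} Λ) (hX : Module.Finite Λ X) :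
    ∃ (s : ℕ) (φ : X →ₗ[Λ] (Fin s → T)), ∀ h : X →ₗ[Λ] T,
      ∃ ψ : (Fin s → T) →ₗ[Λ] T, ψ ∘ₗ φ = h := by
  let : Module R T := Module.compHom T (algebraMap R Λ)
  have : IsScalarTower R Λ T := IsScalarTower.of_algebraMap_smul fun _ _ => rfl
  have : SMulCommClass Λ R T := IsScalarTower.to_smulCommClass'
  have : Module.Finite R T := Module.Finite.trans Λ _
  obtain ⟨n, x, hx⟩ := Module.Finite.exists_fin (R := Λ) (M := X)
  let ev : (X →ₗ[Λ] T) →ₗ[R] (Fin n → T) :=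
    { toFun := fun φ j => φ (x j)
      map_add' := fun _ _ => rfl
      map_smul' := fun _ _ => rfl }
  have hev : Function.Injective ev := by
    intro φ ψ h
    refine LinearMap.ext_on_range hx fun j => congrFun h j
  have : IsNoetherian R (X →ₗ[Λ] T) := isNoetherian_of_injective ev hev
  obtain ⟨s, f, hf⟩ := Module.Finite.exists_fin (R := R) (M := X →ₗ[Λ] T)
  refine ⟨s, LinearMap.pi f, fun h => ?_⟩
  have hh : h ∈ Submodule.span R (Set.range f) := hf ▸ Submodule.mem_top
  obtain ⟨c, hc⟩ := (Submodule.mem_span_range_iff_exists_fun R).1 hh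
  refine ⟨∑ j, c j • LinearMap.proj j, ?_⟩
  rw [← hc]
  ext y
  simp

lemma exists_cogen {R : Type u} [CommRing R] [IsArtinianRing R] [Algebra R Λ]
    [Module.Finite R Λ] (hT : IsCotilting Λ T) (X : ModuleCat.{u} Λ) (hX : X ∈ Perp Λ T) :
    ∃ W ∈ AddClass Λ T, ∃ X' ∈ Perp Λ T, ∃ (f : X →ₗ[Λ] W) (g : W →ₗ[Λ] X'), SES f g := by
  obtain ⟨hTf, -, hTT, hTI⟩ := hT
  have hX' := perp_iff.1 hX
  have hTT' : ∀ i, Van (i + 1) T T := fun i => (bridge i T T).1 (hTT (i + 1) (by omega))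
  obtain ⟨I, j, hIf, hI, hj⟩ := exists_fg_inj (R := R) X hX'.1
  obtain ⟨W, hW, w, hw⟩ : ∃ W ∈ AddClass Λ T, ∃ w : X →ₗ[Λ] W, Function.Injective w := by
    obtain ⟨k, n, -, hn⟩ := hTI I hIf hI
    cases n with
    | zero =>
      obtain ⟨W, hW, ⟨e⟩⟩ := hn
      exact ⟨W, hW, e.symm.toLinearMap ∘ₗ j, e.symm.injective.comp hj⟩
    | succ n =>
      obtain ⟨W, hW, K, f, g, hf, hg, hfg, hK⟩ := hn
      obtain ⟨ψ, hψ⟩ := (SES.mk hf hg hfg).co_lift (van_res hX'.2 n K hK 0) j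
      refine ⟨W, hW, ψ, ?_⟩
      rw [← hψ] at hj
      exact Function.Injective.of_comp (f := g) hj
  obtain ⟨s, φ, hφ⟩ := exists_approx (R := R) hTf X hX'.1
  have hφinj : Function.Injective φ := by
    rw [injective_iff_map_eq_zero]
    intro x hx
    obtain ⟨r, u, p, hpu⟩ := addClass_iff.1 hW
    have h0 : u (w x) = 0 := by
      funext k
      obtain ⟨ψ, hψ⟩ := hφ (LinearMap.proj k ∘ₗ u ∘ₗ w)
      have := congrArg (fun l : X →ₗ[Λ] T => l x) hψ
      simp only [LinearMap.comp_apply, hx, map_zero] at this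
      exact this.symm
    have h1 : w x = 0 := by
      have := congrArg (fun l : W →ₗ[Λ] W => l (w x)) hpu
      simp only [LinearMap.comp_apply, h0, map_zero] at this
      exact this.symm
    exact hw (h1.trans (map_zero w).symm)
  have hses : SES (B := ModuleCat.of Λ (Fin s → T))
      (C := ModuleCat.of Λ ((Fin s → T) ⧸ LinearMap.range φ)) φ (LinearMap.range φ).mkQ :=
    ⟨hφinj, Submodule.mkQ_surjective _, LinearMap.exact_map_mkQ_range φ⟩
  refine ⟨_, addClass_pow T s, ModuleCat.of Λ ((Fin s → T) ⧸ LinearMap.range φ), ?_, φ, _, hses⟩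
  refine perp_iff.2 ⟨Module.Finite.quotient Λ _, fun i => ?_⟩
  cases i with
  | zero => exact hses.contra_hom hφ (van_pow_left (hTT' 0) s)
  | succ i => exact hses.contra_right (hX'.2 i) (van_pow_left (hTT' (i + 1)) s)

lemma perp_ext {A B C : ModuleCat.{u} Λ} {f : A →ₗ[Λ] B} {g : B →ₗ[Λ] C} (h : SES f g)
    (hB : Module.Finite Λ B) (hA : A ∈ Perp Λ T) (hC : C ∈ Perp Λ T) : B ∈ Perp Λ T :=
  perp_iff.2 ⟨hB, fun i => h.contra_mid ((perp_iff.1 hA).2 i) ((perp_iff.1 hC).2 i)⟩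

lemma complete_aux {R : Type u} [CommRing R] [IsArtinianRing R] [Algebra R Λ]
    [Module.Finite R Λ] (hT : IsCotilting Λ T) (n : ℕ) : ∀ M : ModuleCat.{u} Λ, Module.Finite Λ M →
    (∀ i, n ≤ i → Van (i + 1) M T) →
    (∃ X ∈ Perp Λ T, ∃ Y ∈ AddWedge Λ T, ∃ (f : Y →ₗ[Λ] X) (g : X →ₗ[Λ] M), SES f g) ∧
    (∃ Y ∈ AddWedge Λ T, ∃ X ∈ Perp Λ T, ∃ (f : M →ₗ[Λ] Y) (g : Y →ₗ[Λ] X), SES f g) := by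
  induction n with
  | zero =>
    intro M hM h
    have hMp : M ∈ Perp Λ T := perp_iff.2 ⟨hM, fun i => h i (Nat.zero_le i)⟩
    constructor
    · refine ⟨M, hMp, ModuleCat.of Λ (Fin 0 → T), wedge_of_add hT.1 (addClass_pow T 0), 0,
        LinearMap.id, ⟨fun _ _ _ => funext fun j => j.elim0, fun x => ⟨x, rfl⟩, fun x => ?_⟩⟩
      constructor
      · intro hx
        exact ⟨0, hx.symm⟩
      · rintro ⟨y, rfl⟩
        rfl
    · obtain ⟨W, hW, X', hX', f, g, hs⟩ := exists_cogen (R := R) hT M hMp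
      exact ⟨W, wedge_of_add hT.1 hW, X', hX', f, g, hs⟩
  | succ n ih =>
    intro M hM h
    have : IsNoetherian R Λ := isNoetherian_of_isNoetherianRing_of_finite R Λ
    have : IsNoetherianRing Λ := isNoetherian_of_tower R inferInstance
    obtain ⟨r, g, hg⟩ := Module.Finite.exists_fin' Λ M
    have hs : SES (A := ModuleCat.of Λ (LinearMap.ker g)) (B := ModuleCat.of Λ (Fin r → Λ))
        (C := M) (LinearMap.ker g).subtype g :=
      ⟨Subtype.val_injective, hg, LinearMap.exact_subtype_ker_map g⟩
    have hproj : Module.Projective Λ (ModuleCat.of Λ (Fin r → Λ)) :=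
      inferInstanceAs (Module.Projective Λ (Fin r → Λ))
    have hP : ModuleCat.of Λ (Fin r → Λ) ∈ Perp Λ T :=
      perp_iff.2 ⟨inferInstanceAs (Module.Finite Λ (Fin r → Λ)), fun i => van_proj _ _ i⟩
    obtain ⟨-, Y, hY, X, hX, a, b, hab⟩ := ih (ModuleCat.of Λ (LinearMap.ker g))
      (inferInstanceAs (Module.Finite Λ (LinearMap.ker g)))
      (fun i hi => hs.contra_left (van_proj _ _ i) (h (i + 1) (by omega)))
    obtain ⟨P, i, p, j, q, h1, h2, hPf⟩ := pushout_ses hs hab hP.1 hY.1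
    have hPp : P ∈ Perp Λ T := perp_ext h2 hPf hP hX
    refine ⟨⟨P, hPp, Y, hY, i, p, h1⟩, ?_⟩
    obtain ⟨W, hW, X', hX', t, q', h3⟩ := exists_cogen (R := R) hT P hPp
    obtain ⟨V, j', c, m, n', h4, h5, hV⟩ := third_ses h1 h3 (addClass_finite hT.1 hW)
    exact ⟨V, wedge_of_ses h4 hV hY hW, X', hX', m, n', h5⟩

lemma complete {R : Type u} [CommRing R] [IsArtinianRing R] [Algebra R Λ]
    [Module.Finite R Λ] (hT : IsCotilting Λ T) (M : ModuleCat.{u} Λ) (hM : Module.Finite Λ M) :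
    (∃ X ∈ Perp Λ T, ∃ Y ∈ AddWedge Λ T, ∃ (f : Y →ₗ[Λ] X) (g : X →ₗ[Λ] M), SES f g) ∧
    (∃ Y ∈ AddWedge Λ T, ∃ X ∈ Perp Λ T, ∃ (f : M →ₗ[Λ] Y) (g : Y →ₗ[Λ] X), SES f g) := by
  obtain ⟨d, hd⟩ := hT.2.1
  exact complete_aux (R := R) hT d M hM fun i hi => (bridge i M T).1 (hd M (i + 1) (by omega))

lemma wedge_of_van {R : Type u} [CommRing R] [IsArtinianRing R] [Algebra R Λ]
    [Module.Finite R Λ] (hT : IsCotilting Λ T) (Y : ModuleCat.{u} Λ) (hY : Module.Finite Λ Y)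
    (h : ∀ X ∈ Perp Λ T, Van 1 X Y) : Y ∈ AddWedge Λ T := by
  obtain ⟨X, hX, K, hK, f, g, hs⟩ := (complete (R := R) hT Y hY).1
  obtain ⟨W, hW, X', hX', t, q, hs'⟩ := exists_cogen (R := R) hT X hX
  have hv : Van 1 X' X := hs.co_mid (van_wedge hX' hK 0) (h X' hX')
  obtain ⟨ρ, hρ⟩ := hs'.contra_ext hv LinearMap.id
  obtain ⟨r, s, p, hps⟩ := addClass_iff.1 hW
  refine wedge_of_ses hs hY hK (addClass_iff.2 ⟨r, s ∘ₗ t, ρ ∘ₗ p, ?_⟩)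
  calc (ρ ∘ₗ p) ∘ₗ (s ∘ₗ t) = ρ ∘ₗ (p ∘ₗ s) ∘ₗ t := rfl
    _ = LinearMap.id := by rw [hps, LinearMap.id_comp, hρ]

lemma wedge_coker {R : Type u} [CommRing R] [IsArtinianRing R] [Algebra R Λ]
    [Module.Finite R Λ] (hT : IsCotilting Λ T) {A B C : ModuleCat.{u} Λ} {f : A →ₗ[Λ] B}
    {g : B →ₗ[Λ] C} (h : SES f g) (hC : Module.Finite Λ C) (hA : A ∈ AddWedge Λ T)
    (hB : B ∈ AddWedge Λ T) : C ∈ AddWedge Λ T :=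
  wedge_of_van (R := R) hT C hC fun _ hX => h.co_right (van_wedge hX hB 0) (van_wedge hX hA 1)

lemma van_of_van_one {R : Type u} [CommRing R] [IsArtinianRing R] [Algebra R Λ]
    [Module.Finite R Λ] (hT : IsCotilting Λ T) (X : ModuleCat.{u} Λ)
    (h : ∀ Y ∈ AddWedge Λ T, Van 1 X Y) (i : ℕ) : ∀ Y ∈ AddWedge Λ T, Van (i + 1) X Y := by
  induction i with
  | zero => exact h
  | succ i ih =>
    intro Y hY
    obtain ⟨I, j, hIf, hI, hj⟩ := exists_fg_inj (R := R) Y hY.1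
    have hs : SES (C := ModuleCat.of Λ (I ⧸ LinearMap.range j)) j (LinearMap.range j).mkQ :=
      ⟨hj, Submodule.mkQ_surjective _, LinearMap.exact_map_mkQ_range j⟩
    have hq := wedge_coker (R := R) hT hs (Module.Finite.quotient Λ _) hY
      ⟨hIf, hT.2.2.2 I hIf hI⟩
    exact hs.co_left (ih _ hq) (van_inj X I hI (i + 1))

end main

end CotiltAux

/-!
Lemma 4.7(a) of the paper: for an Artin algebra `Λ` and a cotilting finitely
generated left `Λ`-module `T`, the pair `(⊥T, (add T)^∧)` is a hereditary complete
cotorsion pair in `mod Λ`.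
-/

theorem cotilting_cotorsion_pair
    {R : Type u} [CommRing R] [IsArtinianRing R]
    {Λ : Type u} [Ring Λ] [Algebra R Λ] [Module.Finite R Λ]
    (T : ModuleCat.{u} Λ) (hT : IsCotilting Λ T) :
    -- `Ext^1(X, Y) = 0` for `X ∈ ⊥T`, `Y ∈ (add T)^∧`:
    (∀ X ∈ Perp Λ T, ∀ Y ∈ AddWedge Λ T, Subsingleton (ExtGrp Λ 1 X Y)) ∧
    -- a finitely generated `X` left-orthogonal to `(add T)^∧` lies in `⊥T`:
    (∀ X : ModuleCat.{u} Λ, Module.Finite Λ X →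
      (∀ Y ∈ AddWedge Λ T, Subsingleton (ExtGrp Λ 1 X Y)) → X ∈ Perp Λ T) ∧
    -- a finitely generated `Y` right-orthogonal to `⊥T` lies in `(add T)^∧`:
    (∀ Y : ModuleCat.{u} Λ, Module.Finite Λ Y →
      (∀ X ∈ Perp Λ T, Subsingleton (ExtGrp Λ 1 X Y)) → Y ∈ AddWedge Λ T) ∧
    -- completeness:
    (∀ M : ModuleCat.{u} Λ, Module.Finite Λ M →
      (∃ X' ∈ Perp Λ T, ∃ Y' ∈ AddWedge Λ T,
        ∃ (f : (Y' : Type u) →ₗ[Λ] (X' : Type u)) (g : (X' : Type u) →ₗ[Λ] (M : Type u)),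
          Function.Injective f ∧ Function.Surjective g ∧ Function.Exact f g) ∧
      (∃ Y ∈ AddWedge Λ T, ∃ X ∈ Perp Λ T,
        ∃ (f : (M : Type u) →ₗ[Λ] (Y : Type u)) (g : (Y : Type u) →ₗ[Λ] (X : Type u)),
          Function.Injective f ∧ Function.Surjective g ∧ Function.Exact f g)) ∧
    -- `⊥T` is resolving:
    ((∀ P : ModuleCat.{u} Λ, Module.Finite Λ P → Module.Projective Λ P → P ∈ Perp Λ T) ∧
     (∀ (A B C : ModuleCat.{u} Λ) (f : A →ₗ[Λ] B) (g : B →ₗ[Λ] C),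
        Module.Finite Λ B → Function.Injective f → Function.Surjective g →
        Function.Exact f g → A ∈ Perp Λ T → C ∈ Perp Λ T → B ∈ Perp Λ T) ∧
     (∀ (K B C : ModuleCat.{u} Λ) (f : K →ₗ[Λ] B) (g : B →ₗ[Λ] C),
        Module.Finite Λ K → Function.Injective f → Function.Surjective g →
        Function.Exact f g → B ∈ Perp Λ T → C ∈ Perp Λ T → K ∈ Perp Λ T)) ∧
    -- `(add T)^∧` is coresolving:
    ((∀ I : ModuleCat.{u} Λ, Module.Finite Λ I → Module.Injective Λ I → I ∈ AddWedge Λ T) ∧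
     (∀ (A B C : ModuleCat.{u} Λ) (f : A →ₗ[Λ] B) (g : B →ₗ[Λ] C),
        Module.Finite Λ B → Function.Injective f → Function.Surjective g →
        Function.Exact f g → A ∈ AddWedge Λ T → C ∈ AddWedge Λ T → B ∈ AddWedge Λ T) ∧
     (∀ (A B C : ModuleCat.{u} Λ) (f : A →ₗ[Λ] B) (g : B →ₗ[Λ] C),
        Module.Finite Λ C → Function.Injective f → Function.Surjective g →
        Function.Exact f g → A ∈ AddWedge Λ T → B ∈ AddWedge Λ T → C ∈ AddWedge Λ T)) := by
  refine ⟨fun X hX Y hY => (CotiltAux.bridge 0 X Y).2 (CotiltAux.van_wedge hX hY 0), ?_, ?_, ?_,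
    ⟨?_, ?_, ?_⟩, ⟨fun I hI hI' => ⟨hI, hT.2.2.2 I hI hI'⟩, ?_, ?_⟩⟩
  · intro X hX h
    refine CotiltAux.perp_iff.2 ⟨hX, fun i => ?_⟩
    exact CotiltAux.van_of_van_one (R := R) hT X
      (fun Y hY => (CotiltAux.bridge 0 X Y).1 (h Y hY)) i T
      (CotiltAux.wedge_of_add hT.1
        (CotiltAux.addClass_iff.2 ⟨1, LinearMap.pi fun _ => LinearMap.id, LinearMap.proj 0, rfl⟩))
  · intro Y hY h
    exact CotiltAux.wedge_of_van (R := R) hT Y hY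
      fun X hX => (CotiltAux.bridge 0 X Y).1 (h X hX)
  · intro M hM
    obtain ⟨⟨X', hX', Y', hY', f', g', h'⟩, ⟨Y, hY, X, hX, f, g, h⟩⟩ :=
      CotiltAux.complete (R := R) hT M hM
    exact ⟨⟨X', hX', Y', hY', f', g', h'.inj, h'.surj, h'.exact⟩,
      ⟨Y, hY, X, hX, f, g, h.inj, h.surj, h.exact⟩⟩
  · intro P hP hP'
    exact CotiltAux.perp_iff.2 ⟨hP, fun i => CotiltAux.van_proj P T i⟩
  · intro A B C f g hB hf hg hfg hA hC
    exact CotiltAux.perp_ext ⟨hf, hg, hfg⟩ hB hA hC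
  · intro K B C f g hK hf hg hfg hB hC
    exact CotiltAux.perp_iff.2 ⟨hK, fun i => CotiltAux.SES.contra_left ⟨hf, hg, hfg⟩
      ((CotiltAux.perp_iff.1 hB).2 i) ((CotiltAux.perp_iff.1 hC).2 (i + 1))⟩
  · intro A B C f g hB hf hg hfg hA hC
    exact CotiltAux.wedge_of_van (R := R) hT B hB fun X hX => CotiltAux.SES.co_mid
      ⟨hf, hg, hfg⟩ (CotiltAux.van_wedge hX hA 0) (CotiltAux.van_wedge hX hC 0)
  · intro A B C f g hC hf hg hfg hA hB
    exact CotiltAux.wedge_coker (R := R) hT ⟨hf, hg, hfg⟩ hC hA hB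
end

section
/- Let Λ be an Artin algebra and T a cotilting finitely generated left Λ-module. Then: (1) add(T) = ⊥T ∩ (add T)^∧, i.e. a finitely generated module belongs to add(T) if and only if it lies in ⊥T and has finite add(T)-resolution dimension; and (2) (⊥T)^∧ = mod(Λ), i.e. every finitely generated left Λ-module has finite ⊥T-resolution dimension. -/
universe u

open CategoryTheory

/-!
Lemma 4.7(b) of the paper: for an Artin algebra `Λ` and a cotilting finitely
generated left `Λ`-module `T`, one has `add T = ⊥T ∩ (add T)^∧` and
`(⊥T)^∧ = mod Λ` (every finitely generated module has finite `⊥T`-resolution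
dimension).
-/

open CategoryTheory Limits in
/-- Vanishing of derived-functor Ext agrees with vanishing of `Abelian.Ext`. -/
lemma extGrp_iff (Λ : Type u) [Ring Λ] (M N : ModuleCat.{u} Λ) (n : ℕ) :
    Subsingleton (ExtGrp Λ (n + 1) M N) ↔ ∀ e : Abelian.Ext.{u} M N (n + 1), e = 0 := by
  let P := projectiveResolution M
  have h1 : Subsingleton (ExtGrp Λ (n + 1) M N) ↔
      ∀ f : P.complex.X (n + 1) ⟶ N, P.complex.d (n + 2) (n + 1) ≫ f = 0 →
        ∃ g : P.complex.X n ⟶ N, P.complex.d (n + 1) n ≫ g = f := by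
    rw [← ModuleCat.isZero_iff_subsingleton, (P.isoExt (R := ℤ) (n + 1) N).isZero_iff,
      ← HomologicalComplex.exactAt_iff_isZero_homology,
      HomologicalComplex.exactAt_iff' _ n (n + 1) (n + 2) (by simp) (by simp),
      ShortComplex.moduleCat_exact_iff]
    exact Iff.rfl
  rw [h1]
  constructor
  · intro h e
    obtain ⟨f, hf, rfl⟩ := P.extMk_surjective e (n + 2) rfl
    rw [P.extMk_eq_zero_iff f (n + 2) rfl hf n rfl]
    exact h f hf
  · intro h f hf
    exact (P.extMk_eq_zero_iff f (n + 2) rfl hf n rfl).1 (h _)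

/-- The short exact sequence of modules as a short exact short complex. -/
lemma shortExact_of {Λ : Type u} [Ring Λ] {K X M : ModuleCat.{u} Λ}
    (f : K →ₗ[Λ] X) (g : X →ₗ[Λ] M) (hf : Function.Injective f) (hg : Function.Surjective g)
    (h : Function.Exact f g) :
    ∃ w : ModuleCat.ofHom f ≫ ModuleCat.ofHom g = 0,
      (ShortComplex.mk (ModuleCat.ofHom f) (ModuleCat.ofHom g) w).ShortExact := by
  refine ⟨by ext x; exact h.apply_apply_eq_zero x, ?_⟩
  refine { exact := ?_, mono_f := ?_, epi_g := ?_ }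
  · rw [ShortComplex.moduleCat_exact_iff]
    intro x hx
    exact (h x).1 hx
  · exact (ModuleCat.mono_iff_injective _).2 hf
  · exact (ModuleCat.epi_iff_surjective _).2 hg

lemma add_decomp {Λ : Type u} [Ring Λ] {T M : ModuleCat.{u} Λ} (h : M ∈ AddClass Λ T) :
    ∃ (r : ℕ) (π : Fin r → (M ⟶ T)) (ι : Fin r → (T ⟶ M)), 𝟙 M = ∑ j, π j ≫ ι j := by
  obtain ⟨N, r, ⟨e⟩⟩ := h
  refine ⟨r, fun j => ModuleCat.ofHom (LinearMap.proj j ∘ₗ e.toLinearMap ∘ₗ LinearMap.inl Λ M N),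
    fun j => ModuleCat.ofHom (LinearMap.fst Λ M N ∘ₗ e.symm.toLinearMap ∘ₗ
      LinearMap.single Λ (fun _ : Fin r => (T : Type u)) j), ?_⟩
  ext m
  have h1 : ∑ j, Pi.single j (e (m, 0) j) = e (m, 0) := Finset.univ_sum_single _
  have h2 := congrArg (fun x => (e.symm x).1) h1
  simp only [map_sum, LinearEquiv.symm_apply_apply, Prod.fst_sum] at h2
  rw [ModuleCat.hom_sum, LinearMap.sum_apply]
  exact h2.symm

lemma add_finite {Λ : Type u} [Ring Λ] {T M : ModuleCat.{u} Λ} (hT : Module.Finite Λ T)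
    (h : M ∈ AddClass Λ T) : Module.Finite Λ M := by
  obtain ⟨N, r, ⟨e⟩⟩ := h
  refine Module.Finite.of_surjective (LinearMap.fst Λ M N ∘ₗ e.symm.toLinearMap) ?_
  intro m
  exact ⟨e (m, 0), by simp⟩

/-- A retract of a module in `add T` is in `add T`. -/
lemma add_retract {Λ : Type u} [Ring Λ] {T X M : ModuleCat.{u} Λ} (h : X ∈ AddClass Λ T)
    (s : M →ₗ[Λ] X) (p : X →ₗ[Λ] M) (hsp : ∀ m, p (s m) = m) : M ∈ AddClass Λ T := by
  obtain ⟨N, r, ⟨e⟩⟩ := h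
  let e' : (M × (LinearMap.ker p × N)) ≃ₗ[Λ] (X × N) :=
    { toFun := fun x => (s x.1 + x.2.1, x.2.2)
      invFun := fun x => (p x.1, (⟨x.1 - s (p x.1), by simp [hsp]⟩, x.2))
      map_add' := fun x y => by
        ext <;> simp
        abel
      map_smul' := fun c x => by ext <;> simp
      left_inv := fun x => by
        obtain ⟨m, ⟨k, hk⟩, n⟩ := x
        have hk' : p k = 0 := hk
        ext <;> simp [hsp, hk']
      right_inv := fun x => by ext <;> simp }
  exact ⟨ModuleCat.of Λ (LinearMap.ker p × N), r, ⟨e'.trans e⟩⟩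

open Abelian in
lemma ext_add_left {Λ : Type u} [Ring Λ] {T M Y : ModuleCat.{u} Λ} (h : M ∈ AddClass Λ T) (n : ℕ)
    (hY : ∀ e : Ext.{u} T Y n, e = 0) (e : Ext.{u} M Y n) : e = 0 := by
  obtain ⟨r, π, ι, hd⟩ := add_decomp h
  rw [← Ext.mk₀_id_comp e, hd, Ext.mk₀_sum, Ext.sum_comp]
  refine Finset.sum_eq_zero fun j _ => ?_
  rw [← Ext.mk₀_comp_mk₀, Ext.comp_assoc_of_second_deg_zero,
    hY ((Ext.mk₀ (ι j)).comp e (zero_add n)), Ext.comp_zero]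

open Abelian in
lemma ext_add_right {Λ : Type u} [Ring Λ] {T M Y : ModuleCat.{u} Λ} (h : Y ∈ AddClass Λ T) (n : ℕ)
    (hM : ∀ e : Ext.{u} M T n, e = 0) (e : Ext.{u} M Y n) : e = 0 := by
  obtain ⟨r, π, ι, hd⟩ := add_decomp h
  rw [← Ext.comp_mk₀_id e, hd, Ext.mk₀_sum, Ext.comp_sum]
  refine Finset.sum_eq_zero fun j _ => ?_
  rw [← Ext.mk₀_comp_mk₀, ← Ext.comp_assoc_of_second_deg_zero,
    hM (e.comp (Ext.mk₀ (π j)) (add_zero n)), Ext.zero_comp]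

open Abelian in
lemma add_of_res {Λ : Type u} [Ring Λ] {T : ModuleCat.{u} Λ}
    (hTT : ∀ n, ∀ e : Ext.{u} T T (n + 1), e = 0) (k : ℕ) :
    ∀ M : ModuleCat.{u} Λ, (∀ n, ∀ e : Ext.{u} M T (n + 1), e = 0) →
      ResolutionOfLength Λ (AddClass Λ T) k M → M ∈ AddClass Λ T := by
  induction k with
  | zero =>
    rintro M - ⟨X, hX, ⟨e⟩⟩
    exact add_retract hX e.symm.toLinearMap e.toLinearMap (by simp)
  | succ k ih =>
    rintro M hM ⟨X, hX, K, f, g, hf, hg, hfg, hK⟩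
    obtain ⟨w, hS⟩ := shortExact_of f g hf hg hfg
    have hKT : ∀ n, ∀ e : Ext.{u} K T (n + 1), e = 0 := by
      intro n e
      obtain ⟨x, hx⟩ := Ext.contravariant_sequence_exact₁ hS T e (n₁ := n + 1 + 1)
        (by omega) (hM _ _)
      rw [← hx, ext_add_left hX (n + 1) (hTT n) x, Ext.comp_zero]
    have hKadd := ih K hKT hK
    obtain ⟨x, hx⟩ := Ext.covariant_sequence_exact₃ M hS (Ext.mk₀ (𝟙 M)) (n₁ := 1) (by omega)
      (ext_add_right hKadd 1 (hM 0) _)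
    obtain ⟨s, rfl⟩ := Ext.mk₀_bijective _ _ |>.surjective x
    rw [Ext.mk₀_comp_mk₀] at hx
    have hs := (Ext.mk₀_bijective _ _).injective hx
    refine add_retract hX s.hom g fun m => ?_
    exact ConcreteCategory.congr_hom hs m

open Abelian in
lemma perp_res {Λ : Type u} [Ring Λ] [IsNoetherianRing Λ] {T : ModuleCat.{u} Λ} (d : ℕ) :
    ∀ M : ModuleCat.{u} Λ, Module.Finite Λ M → (∀ n, ∀ e : Ext.{u} M T (d + n + 1), e = 0) →
      ResolutionOfLength Λ (Perp Λ T) d M := by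
  induction d with
  | zero =>
    intro M hM h
    refine ⟨M, ⟨hM, fun i hi => ?_⟩, ⟨LinearEquiv.refl _ _⟩⟩
    obtain ⟨n, rfl⟩ : ∃ n, i = n + 1 := ⟨i - 1, by omega⟩
    rw [extGrp_iff]
    have := h n
    rwa [zero_add] at this
  | succ d ih =>
    intro M hM h
    obtain ⟨r, g, hg⟩ := Module.Finite.exists_fin' Λ M
    let X := ModuleCat.of Λ (Fin r → Λ)
    have hproj : Projective X := ModuleCat.projective_of_free (Pi.basisFun Λ (Fin r))
    let K := ModuleCat.of Λ (LinearMap.ker g)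
    refine ⟨X, ⟨inferInstanceAs (Module.Finite Λ (Fin r → Λ)), fun i hi => ?_⟩, K,
      (LinearMap.ker g).subtype, g, Subtype.val_injective, hg, ?_, ?_⟩
    · obtain ⟨n, rfl⟩ : ∃ n, i = n + 1 := ⟨i - 1, by omega⟩
      rw [extGrp_iff]
      exact fun e => Ext.eq_zero_of_projective e
    · exact LinearMap.exact_subtype_ker_map g
    · refine ih K (inferInstanceAs (Module.Finite Λ (LinearMap.ker g))) fun n e => ?_
      obtain ⟨w, hS⟩ := shortExact_of (K := K) (X := X) (LinearMap.ker g).subtype g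
        Subtype.val_injective hg (LinearMap.exact_subtype_ker_map g)
      obtain ⟨x, hx⟩ := Ext.contravariant_sequence_exact₁ hS T e (n₁ := d + 1 + n + 1)
        (by omega) (h _ _)
      rw [← hx, Ext.eq_zero_of_projective x, Ext.comp_zero]

theorem cotilting_add_eq_perp_inter_wedge
    {R : Type u} [CommRing R] [IsArtinianRing R]
    {Λ : Type u} [Ring Λ] [Algebra R Λ] [Module.Finite R Λ]
    (T : ModuleCat.{u} Λ) (hT : IsCotilting Λ T) :
    AddClass Λ T = Perp Λ T ∩ AddWedge Λ T ∧
    (∀ M : ModuleCat.{u} Λ, Module.Finite Λ M →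
      ∃ k : ℕ, ResdimLE Λ (Perp Λ T) k M) := by
  obtain ⟨hfin, ⟨d, hd⟩, hTT, -⟩ := hT
  have : IsNoetherianRing Λ := isNoetherian_of_tower R (inferInstance : IsNoetherian R Λ)
  have hTT' : ∀ n, ∀ e : Abelian.Ext.{u} T T (n + 1), e = 0 := fun n =>
    (extGrp_iff Λ T T n).1 (hTT (n + 1) (by omega))
  refine ⟨Set.Subset.antisymm ?_ ?_, ?_⟩
  · intro M hM
    have hMf := add_finite hfin hM
    refine ⟨⟨hMf, fun i hi => ?_⟩, hMf, 0, 0, le_rfl, M, hM, ⟨LinearEquiv.refl _ _⟩⟩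
    obtain ⟨n, rfl⟩ : ∃ n, i = n + 1 := ⟨i - 1, by omega⟩
    rw [extGrp_iff]
    exact ext_add_left hM (n + 1) (hTT' n)
  · rintro M ⟨⟨-, hM⟩, -, k, n, -, hres⟩
    exact add_of_res hTT' n M
      (fun i => (extGrp_iff Λ M T i).1 (hM (i + 1) (by omega))) hres
  · intro M hM
    refine ⟨d, d, le_rfl, perp_res d M hM fun n => ?_⟩
    exact (extGrp_iff Λ M T (d + n)).1 (hd M _ (by omega))
end

section
/- Let Λ be an Artin algebra which is n-Gorenstein, i.e. the injective dimension of Λ as a left Λ-module and the injective dimension of Λ as a right Λ-module are both equal to the finite number n. Then the finitistic dimension of Λ equals n: every finitely generated left Λ-module of finite projective dimension has projective dimension at most n, and there exists a finitely generated left Λ-module of projective dimension exactly n. -/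
universe u

open CategoryTheory

/-- `PdLE Λ k M` : the projective dimension of `M` is at most `k`,
expressed by the vanishing of `Ext^j_Λ(M, -)` for all `j > k`. -/
def PdLE (Λ : Type u) [Ring Λ] (k : ℕ) (M : ModuleCat.{u} Λ) : Prop :=
  ∀ (N : ModuleCat.{u} Λ) (j : ℕ), k < j → Subsingleton (ExtGrp Λ j M N)

/-- `IdLE Λ k N` : the injective dimension of `N` is at most `k`,
expressed by the vanishing of `Ext^j_Λ(-, N)` for all `j > k`. -/
def IdLE (Λ : Type u) [Ring Λ] (k : ℕ) (N : ModuleCat.{u} Λ) : Prop :=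
  ∀ (M : ModuleCat.{u} Λ) (j : ℕ), k < j → Subsingleton (ExtGrp Λ j M N)


section Aux

open Abelian

lemma subsingleton_extGrp_iff {Λ : Type u} [Ring Λ] (i : ℕ) (M N : ModuleCat.{u} Λ) :
    Subsingleton (ExtGrp Λ (i + 1) M N) ↔ Subsingleton (Abelian.Ext M N (i + 1)) := by
  let P := projectiveResolution M
  have h1 : Subsingleton (ExtGrp Λ (i + 1) M N) ↔
      ∀ f : P.complex.X (i + 1) ⟶ N, P.complex.d (i + 2) (i + 1) ≫ f = 0 →
        ∃ g : P.complex.X i ⟶ N, P.complex.d (i + 1) i ≫ g = f := by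
    rw [← ModuleCat.isZero_iff_subsingleton, (P.isoExt (R := ℤ) (i + 1) N).isZero_iff,
      ← HomologicalComplex.exactAt_iff_isZero_homology,
      HomologicalComplex.exactAt_iff' _ i (i + 1) (i + 2) (by simp) (by simp),
      ShortComplex.moduleCat_exact_iff]
    rfl
  rw [h1]
  constructor
  · intro h
    refine subsingleton_of_forall_eq 0 fun e => ?_
    obtain ⟨f, hf, rfl⟩ := P.extMk_surjective e (i + 2) rfl
    rw [P.extMk_eq_zero_iff f _ _ hf i rfl]
    exact h f hf
  · intro h f hf
    exact (P.extMk_eq_zero_iff f (i + 2) rfl hf i rfl).1 (Subsingleton.elim _ _)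

/-- Vanishing of `Ext^i(M, N)` for unbundled modules. -/
def VE (Λ : Type u) [Ring Λ] (i : ℕ) (M N : Type u) [AddCommGroup M] [Module Λ M]
    [AddCommGroup N] [Module Λ N] : Prop :=
  ∀ e : Abelian.Ext (ModuleCat.of Λ M) (ModuleCat.of Λ N) i, e = 0

section VE
variable {Λ : Type u} [Ring Λ] {A B C N : Type u} [AddCommGroup A] [Module Λ A]
  [AddCommGroup B] [Module Λ B] [AddCommGroup C] [Module Λ C] [AddCommGroup N] [Module Λ N]
  {f : A →ₗ[Λ] B} {g : B →ₗ[Λ] C}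

/-- bundled short complex -/
noncomputable abbrev mkSC (h : Function.Exact f g) : ShortComplex (ModuleCat.{u} Λ) :=
  ShortComplex.mk (ModuleCat.ofHom f) (ModuleCat.ofHom g) (by
    rw [← ModuleCat.ofHom_comp, h.linearMap_comp_eq_zero]; rfl)

lemma mkSC_exact (hf : Function.Injective f) (h : Function.Exact f g)
    (hg : Function.Surjective g) : (mkSC h).ShortExact where
  exact := (ShortComplex.moduleCat_exact_iff _).2 fun x hx => (h x).1 hx
  mono_f := (ModuleCat.mono_iff_injective _).2 hf
  epi_g := (ModuleCat.epi_iff_surjective _).2 hg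

lemma VE.contra₃ (hf : Function.Injective f) (h : Function.Exact f g)
    (hg : Function.Surjective g) {i : ℕ} (h1 : VE Λ i A N) (h2 : VE Λ (i + 1) B N) :
    VE Λ (i + 1) C N := by
  intro e
  obtain ⟨x, rfl⟩ := Ext.contravariant_sequence_exact₃ (mkSC_exact hf h hg) _ e (h2 _)
    (add_comm 1 i)
  rw [h1 x]; simp

lemma VE.contra₂ (hf : Function.Injective f) (h : Function.Exact f g)
    (hg : Function.Surjective g) {i : ℕ} (h1 : VE Λ i A N) (h2 : VE Λ i C N) :
    VE Λ i B N := by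
  intro e
  obtain ⟨x, rfl⟩ := Ext.contravariant_sequence_exact₂ (mkSC_exact hf h hg) _ e (h1 _)
  rw [h2 x]; simp

lemma VE.contra₁ (hf : Function.Injective f) (h : Function.Exact f g)
    (hg : Function.Surjective g) {i : ℕ} (h1 : VE Λ i B N) (h2 : VE Λ (i + 1) C N) :
    VE Λ i A N := by
  intro e
  obtain ⟨x, rfl⟩ := Ext.contravariant_sequence_exact₁ (mkSC_exact hf h hg) _ e
    (add_comm 1 i) (h2 _)
  rw [h1 x]; simp

lemma VE.co₂ (hf : Function.Injective f) (h : Function.Exact f g)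
    (hg : Function.Surjective g) {i : ℕ} (h1 : VE Λ i N A) (h2 : VE Λ i N C) :
    VE Λ i N B := by
  intro e
  obtain ⟨x, rfl⟩ := Ext.covariant_sequence_exact₂ _ (mkSC_exact hf h hg) e (h2 _)
  rw [h1 x]; simp

lemma VE.co₃ (hf : Function.Injective f) (h : Function.Exact f g)
    (hg : Function.Surjective g) {i : ℕ} (h1 : VE Λ i N B) (h2 : VE Λ (i + 1) N A) :
    VE Λ i N C := by
  intro e
  obtain ⟨x, rfl⟩ := Ext.covariant_sequence_exact₃ _ (mkSC_exact hf h hg) e rfl (h2 _)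
  rw [h1 x]; simp

lemma VE.co₁ (hf : Function.Injective f) (h : Function.Exact f g)
    (hg : Function.Surjective g) {i : ℕ} (h1 : VE Λ i N C) (h2 : VE Λ (i + 1) N B) :
    VE Λ (i + 1) N A := by
  intro e
  obtain ⟨x, rfl⟩ := Ext.covariant_sequence_exact₁ _ (mkSC_exact hf h hg) e (h2 _) rfl
  rw [h1 x]; simp

lemma VE.proj [Module.Projective Λ A] (i : ℕ) : VE Λ (i + 1) A N := by
  have := (IsProjective.iff_projective A).1 (inferInstance : Module.Projective Λ A)
  intro e
  exact Ext.eq_zero_of_projective e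

lemma VE.inj [Module.Injective Λ A] (i : ℕ) : VE Λ (i + 1) N A := by
  have := Module.injective_object_of_injective_module Λ A
  intro e
  exact Ext.eq_zero_of_injective e

lemma VE.extend (hf : Function.Injective f) (h : Function.Exact f g)
    (hg : Function.Surjective g) (h1 : VE Λ 1 C N) (φ : A →ₗ[Λ] N) :
    ∃ ψ : B →ₗ[Λ] N, ψ ∘ₗ f = φ := by
  obtain ⟨x, hx⟩ := Ext.contravariant_sequence_exact₁ (mkSC_exact hf h hg) _
    (Ext.mk₀ (ModuleCat.ofHom φ)) (add_zero 1) (h1 _)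
  obtain ⟨ψ, rfl⟩ := Ext.homEquiv₀.symm.surjective x
  refine ⟨ψ.hom, ?_⟩
  have : (Ext.mk₀ (ModuleCat.ofHom f)).comp (Ext.mk₀ ψ) (zero_add 0) =
    (Ext.mk₀ (ModuleCat.ofHom φ)) := hx
  rw [Ext.mk₀_comp_mk₀] at this
  have := Ext.mk₀_bijective _ _ |>.1 this
  exact congrArg ModuleCat.Hom.hom this

lemma VE.of_extend [Module.Projective Λ B] (hf : Function.Injective f) (h : Function.Exact f g)
    (hg : Function.Surjective g) (H : ∀ φ : A →ₗ[Λ] N, ∃ ψ : B →ₗ[Λ] N, ψ ∘ₗ f = φ) :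
    VE Λ 1 C N := by
  intro e
  have S := mkSC_exact hf h hg
  obtain ⟨x, rfl⟩ := Ext.contravariant_sequence_exact₃ S _ e (VE.proj 0 _)
    (add_zero 1)
  obtain ⟨φ, rfl⟩ := Ext.homEquiv₀.symm.surjective x
  obtain ⟨ψ, hψ⟩ := H φ.hom
  have : Ext.homEquiv₀.symm φ = (Ext.mk₀ (ModuleCat.ofHom f)).comp
      (Ext.mk₀ (ModuleCat.ofHom ψ)) (zero_add 0) := by
    rw [Ext.mk₀_comp_mk₀, ← ModuleCat.ofHom_comp, hψ]
    rfl
  rw [this]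
  exact S.extClass_comp_assoc _

lemma VE.congr_right (e : A ≃ₗ[Λ] B) {i : ℕ} (h : VE Λ i N A) : VE Λ i N B := by
  refine VE.co₂ (f := e.toLinearMap) (g := (0 : B →ₗ[Λ] PUnit.{u+1})) e.injective ?_ ?_ h ?_
  · intro x; simp
  · intro x; exact ⟨0, rfl⟩
  · intro x
    have : Limits.IsZero (ModuleCat.of Λ PUnit.{u+1}) := ModuleCat.isZero_of_subsingleton _
    have h0 : Ext.mk₀ (𝟙 (ModuleCat.of Λ PUnit.{u+1})) = 0 := by
      rw [this.eq_of_src (𝟙 _) 0]; simp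
    rw [← x.comp_mk₀_id, h0]; simp

end VE

section B
variable {Λ : Type u} [Ring Λ] {A B C M N : Type u} [AddCommGroup A] [Module Λ A]
  [AddCommGroup B] [Module Λ B] [AddCommGroup C] [Module Λ C] [AddCommGroup N] [Module Λ N]
  [AddCommGroup M] [Module Λ M]

lemma exact_subtype_ker (g : B →ₗ[Λ] C) : Function.Exact (LinearMap.ker g).subtype g :=
  LinearMap.exact_subtype_ker_map g

lemma VE.of_subsingleton_right [Subsingleton A] (i : ℕ) : VE Λ i N A := by
  intro x
  have : Limits.IsZero (ModuleCat.of Λ A) := ModuleCat.isZero_of_subsingleton _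
  have h0 : Ext.mk₀ (𝟙 (ModuleCat.of Λ A)) = 0 := by
    rw [this.eq_of_src (𝟙 _) 0]; simp
  rw [← x.comp_mk₀_id, h0]; simp

lemma VE.prod {i : ℕ} (h1 : VE Λ i N A) (h2 : VE Λ i N B) : VE Λ i N (A × B) :=
  VE.co₂ (f := LinearMap.inl Λ A B) (g := LinearMap.snd Λ A B) LinearMap.inl_injective
    Function.Exact.inl_snd LinearMap.snd_surjective h1 h2

lemma VE.pi {i : ℕ} (h1 : VE Λ i N Λ) (m : ℕ) : VE Λ i N (Fin m → Λ) := by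
  induction m with
  | zero => exact VE.of_subsingleton_right i
  | succ m ih => exact VE.congr_right (Fin.consLinearEquiv Λ (fun _ => Λ)) (VE.prod h1 ih)

lemma VE.fg_of_top [Module.Finite Λ A] {i : ℕ} (h1 : VE Λ i N Λ)
    (h2 : ∀ (K : Type u) [AddCommGroup K] [Module Λ K], VE Λ (i + 1) N K) : VE Λ i N A := by
  obtain ⟨m, g, hg⟩ := Module.Finite.exists_fin' Λ A
  exact VE.co₃ (Subtype.val_injective) (exact_subtype_ker g) hg (VE.pi h1 m) (h2 _)

lemma pd_step [IsNoetherianRing Λ] (k : ℕ) : ∀ (M : Type u) [AddCommGroup M] [Module Λ M]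
    [Module.Finite Λ M], VE Λ (k + 1) M Λ →
    (∀ (K : Type u) [AddCommGroup K] [Module Λ K], VE Λ (k + 2) M K) →
    ∀ (K : Type u) [AddCommGroup K] [Module Λ K], VE Λ (k + 1) M K := by
  induction k with
  | zero =>
    intro M _ _ _ h1 h2 N _ _
    obtain ⟨m, g, hg⟩ := Module.Finite.exists_fin' Λ M
    have : VE Λ 1 M (LinearMap.ker g) := VE.fg_of_top h1 h2
    obtain ⟨r, hr⟩ := VE.extend (Subtype.val_injective) (exact_subtype_ker g) hg this LinearMap.id
    refine VE.of_extend (Subtype.val_injective) (exact_subtype_ker g) hg fun φ => ⟨φ ∘ₗ r, ?_⟩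
    rw [LinearMap.comp_assoc, hr, LinearMap.comp_id]
  | succ k ih =>
    intro M _ _ _ h1 h2 N _ _
    obtain ⟨m, g, hg⟩ := Module.Finite.exists_fin' Λ M
    refine VE.contra₃ (Subtype.val_injective) (exact_subtype_ker g) hg ?_ (VE.proj _)
    refine ih _ ?_ ?_ _
    · exact VE.contra₁ (Subtype.val_injective) (exact_subtype_ker g) hg (VE.proj _) h1
    · intro K _ _
      exact VE.contra₁ (Subtype.val_injective) (exact_subtype_ker g) hg (VE.proj _) (h2 _)

lemma pd_le [IsNoetherianRing Λ] (n : ℕ)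
    (hl : ∀ (M : Type u) [AddCommGroup M] [Module Λ M] (j : ℕ), n < j → VE Λ j M Λ)
    (M : Type u) [AddCommGroup M] [Module Λ M] [Module.Finite Λ M] (d : ℕ) :
    (∀ (K : Type u) [AddCommGroup K] [Module Λ K] (j : ℕ), n + d < j → VE Λ j M K) →
    ∀ (K : Type u) [AddCommGroup K] [Module Λ K] (j : ℕ), n < j → VE Λ j M K := by
  induction d with
  | zero => exact fun h => h
  | succ d ih =>
    intro h
    refine ih fun K _ _ j hj => ?_
    obtain rfl | hj' := (Nat.succ_le_of_lt hj).eq_or_lt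
    · exact pd_step (n + d) M (hl M _ (by omega)) (fun K _ _ => h K _ (by omega)) K
    · exact h K j (by omega)

lemma baer_step (d : ℕ) : ∀ (N : Type u) [AddCommGroup N] [Module Λ N],
    (∀ I : Ideal Λ, VE Λ (d + 1) (Λ ⧸ I) N) →
    ∀ (M : Type u) [AddCommGroup M] [Module Λ M], VE Λ (d + 1) M N := by
  induction d with
  | zero =>
    intro N _ _ h M _ _
    have : Module.Baer Λ N := by
      intro I φ
      obtain ⟨ψ, hψ⟩ := VE.extend (f := I.subtype) (g := I.mkQ) Subtype.val_injective
        (LinearMap.exact_subtype_mkQ I) (Submodule.mkQ_surjective I) (h I) φ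
      exact ⟨ψ, fun x hx => LinearMap.congr_fun hψ ⟨x, hx⟩⟩
    have := this.injective
    exact VE.inj 0
  | succ d ih =>
    intro N _ _ h M _ _
    let E : ModuleCat.{u} Λ := Injective.under (ModuleCat.of Λ N)
    let f : N →ₗ[Λ] E := (Injective.ι (ModuleCat.of Λ N)).hom
    have hf : Function.Injective f := (ModuleCat.mono_iff_injective _).1 inferInstance
    have hE : Injective (ModuleCat.of Λ E) := inferInstanceAs (Injective (Injective.under _))
    have : Module.Injective Λ E := Module.injective_module_of_injective_object Λ E
    have hx : Function.Exact f (LinearMap.range f).mkQ := LinearMap.exact_map_mkQ_range f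
    refine VE.co₁ hf hx (Submodule.mkQ_surjective _) (ih _ ?_ M) (VE.inj _)
    exact fun I => VE.co₃ hf hx (Submodule.mkQ_surjective _) (VE.inj _) (h I)

end B

section D
variable {Λ : Type u} [Ring Λ] {A B C M N : Type u} [AddCommGroup A] [Module Λ A]
  [AddCommGroup B] [Module Λ B] [AddCommGroup C] [Module Λ C] [AddCommGroup N] [Module Λ N]
  [AddCommGroup M] [Module Λ M]

/-- the class of modules with all higher Ext to `Λ` vanishing -/
def GP (Λ : Type u) [Ring Λ] (M : Type u) [AddCommGroup M] [Module Λ M] : Prop :=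
  ∀ j : ℕ, VE Λ (j + 1) M Λ

/-- transpose -/
def dmap (f : A →ₗ[Λ] B) : (B →ₗ[Λ] Λ) →ₗ[Λᵐᵒᵖ] (A →ₗ[Λ] Λ) :=
  LinearMap.lcomp Λᵐᵒᵖ Λ f

@[simp] lemma dmap_apply (f : A →ₗ[Λ] B) (φ : B →ₗ[Λ] Λ) : dmap f φ = φ ∘ₗ f := rfl

/-- evaluation -/
def evl (p : A) : (A →ₗ[Λ] Λ) →ₗ[Λᵐᵒᵖ] Λ where
  toFun φ := φ p
  map_add' _ _ := rfl
  map_smul' _ _ := rfl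

lemma dmap_inj {g : B →ₗ[Λ] C} (hg : Function.Surjective g) : Function.Injective (dmap g) := by
  intro a b h
  ext x
  obtain ⟨y, rfl⟩ := hg x
  exact LinearMap.congr_fun h y

lemma dmap_exact {f : A →ₗ[Λ] B} {g : B →ₗ[Λ] C} (h : Function.Exact f g)
    (hg : Function.Surjective g) : Function.Exact (dmap g) (dmap f) := by
  intro φ
  constructor
  · intro hφ
    have hk : LinearMap.ker g ≤ LinearMap.ker φ := by
      intro x hx
      obtain ⟨y, rfl⟩ := (h x).1 hx
      exact LinearMap.congr_fun hφ y
    refine ⟨(LinearMap.ker g).liftQ φ hk ∘ₗ (g.quotKerEquivOfSurjective hg).symm.toLinearMap, ?_⟩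
    ext x
    have : (g.quotKerEquivOfSurjective hg).symm (g x) = (LinearMap.ker g).mkQ x := by
      rw [LinearEquiv.symm_apply_eq]; rfl
    simp [this]
  · rintro ⟨ψ, rfl⟩
    ext x
    simp [h.apply_apply_eq_zero]

/-- `Λ` as a right module is the regular module of the opposite ring -/
def opEquiv (Λ : Type u) [Ring Λ] : Λᵐᵒᵖ ≃ₗ[Λᵐᵒᵖ] Λ where
  toFun x := x.unop
  invFun x := MulOpposite.op x
  map_add' _ _ := rfl
  map_smul' _ _ := rfl
  left_inv _ := rfl
  right_inv _ := rfl

instance : Module.Free Λᵐᵒᵖ Λ := Module.Free.of_equiv (opEquiv Λ)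
instance : Module.Finite Λᵐᵒᵖ Λ := Module.Finite.equiv (opEquiv Λ)

instance dual_free (m : ℕ) : Module.Free Λᵐᵒᵖ ((Fin m → Λ) →ₗ[Λ] Λ) :=
  Module.Free.of_equiv ((Pi.basisFun Λ (Fin m)).constr Λᵐᵒᵖ (M' := Λ))

instance dual_fin (m : ℕ) : Module.Finite Λᵐᵒᵖ ((Fin m → Λ) →ₗ[Λ] Λ) :=
  Module.Finite.equiv ((Pi.basisFun Λ (Fin m)).constr Λᵐᵒᵖ (M' := Λ))

lemma evl_surj (m : ℕ) (ψ : ((Fin m → Λ) →ₗ[Λ] Λ) →ₗ[Λᵐᵒᵖ] Λ) :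
    ∃ q : Fin m → Λ, ψ = evl q := by
  refine ⟨fun i => ψ (LinearMap.proj i), ?_⟩
  ext φ
  have : φ = ∑ i, MulOpposite.op (φ (Pi.single i 1)) • (LinearMap.proj i : (Fin m → Λ) →ₗ[Λ] Λ) := by
    refine (Pi.basisFun Λ (Fin m)).ext fun j => ?_
    simp [LinearMap.sum_apply, Pi.single_apply]
  conv_lhs => rw [this]
  rw [map_sum]
  simp only [map_smul]
  change _ = φ _
  conv_rhs => rw [pi_eq_sum_univ' (fun i => ψ (LinearMap.proj i)), map_sum]
  refine Finset.sum_congr rfl fun i _ => ?_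
  rw [map_smul]
  rfl

lemma proj_sep (m : ℕ) (p q : Fin m → Λ) (h : ∀ f : (Fin m → Λ) →ₗ[Λ] Λ, f p = f q) : p = q := by
  ext i
  exact h (LinearMap.proj i)

lemma GP.ker {G : Type u} [AddCommGroup G] [Module Λ G] (hG : GP Λ G)
    {m : ℕ} {g : (Fin m → Λ) →ₗ[Λ] G} (hg : Function.Surjective g) :
    GP Λ (LinearMap.ker g) := fun j =>
  VE.contra₁ Subtype.val_injective (exact_subtype_ker g) hg (VE.proj _) (hG (j + 1))

lemma GP.dmap_surj {G : Type u} [AddCommGroup G] [Module Λ G] (hG : GP Λ G)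
    {m : ℕ} {g : (Fin m → Λ) →ₗ[Λ] G} (hg : Function.Surjective g) :
    Function.Surjective (dmap (LinearMap.ker g).subtype) := fun φ =>
  VE.extend Subtype.val_injective (exact_subtype_ker g) hg (hG 0) φ

lemma dual_van [IsNoetherianRing Λ] (n : ℕ)
    (hr : ∀ (X : Type u) [AddCommGroup X] [Module Λᵐᵒᵖ X] (j : ℕ), n < j → VE Λᵐᵒᵖ j X Λ)
    (d : ℕ) : ∀ (G : Type u) [AddCommGroup G] [Module Λ G] [Module.Finite Λ G],
    GP Λ G → ∀ j, n < j + 1 + d → VE Λᵐᵒᵖ (j + 1) (G →ₗ[Λ] Λ) Λ := by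
  induction d with
  | zero => exact fun G _ _ _ hG j hj => hr _ _ hj
  | succ d ih =>
    intro G _ _ _ hG j hj
    obtain ⟨m, g, hg⟩ := Module.Finite.exists_fin' Λ G
    exact VE.contra₁ (dmap_inj hg) (dmap_exact (exact_subtype_ker g) hg) (hG.dmap_surj hg)
      (VE.proj _) (ih _ (hG.ker hg) (j + 1) (by omega))

lemma torsionless [IsNoetherianRing Λ] (n : ℕ)
    (hr : ∀ (X : Type u) [AddCommGroup X] [Module Λᵐᵒᵖ X] (j : ℕ), n < j → VE Λᵐᵒᵖ j X Λ)
    (G : Type u) [AddCommGroup G] [Module Λ G] [Module.Finite Λ G] (hG : GP Λ G)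
    (x : G) (hx : ∀ f : G →ₗ[Λ] Λ, f x = 0) : x = 0 := by
  obtain ⟨m, g, hg⟩ := Module.Finite.exists_fin' Λ G
  have hK := hG.ker hg
  obtain ⟨m', g', hg'⟩ := Module.Finite.exists_fin' Λ (LinearMap.ker g)
  have hK2 := hK.ker hg'
  obtain ⟨p, rfl⟩ := hg x
  -- evaluation at `p` factors through the dual of the kernel
  have hs := hG.dmap_surj hg
  have hle : LinearMap.ker (dmap (LinearMap.ker g).subtype) ≤ LinearMap.ker (evl p) := by
    intro f hf
    obtain ⟨φ, rfl⟩ := (dmap_exact (exact_subtype_ker g) hg f).1 hf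
    exact hx φ
  let φ : (LinearMap.ker g →ₗ[Λ] Λ) →ₗ[Λᵐᵒᵖ] Λ :=
    (LinearMap.ker (dmap (LinearMap.ker g).subtype)).liftQ (evl p) hle ∘ₗ
      (LinearMap.quotKerEquivOfSurjective _ hs).symm.toLinearMap
  have hφ : ∀ f, φ (dmap (LinearMap.ker g).subtype f) = f p := by
    intro f
    have : (LinearMap.quotKerEquivOfSurjective _ hs).symm (dmap (LinearMap.ker g).subtype f) =
        (LinearMap.ker (dmap (LinearMap.ker g).subtype)).mkQ f := by
      rw [LinearEquiv.symm_apply_eq]; rfl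
    simp only [φ, LinearMap.comp_apply, LinearEquiv.coe_coe, this]
    rfl
  obtain ⟨ψ, hψ⟩ := VE.extend (dmap_inj hg') (dmap_exact (exact_subtype_ker g') hg')
    (hK.dmap_surj hg') (dual_van n hr n _ hK2 0 (by omega)) φ
  obtain ⟨q, rfl⟩ := evl_surj m' ψ
  have : p = (g' q : Fin m → Λ) := by
    refine proj_sep m _ _ fun f => ?_
    rw [← hφ f, ← hψ]
    rfl
  rw [this]
  exact (g' q).2

/-- every f.g. module in `GP` embeds in a f.g. free module with cokernel in `GP` -/
lemma embed [IsNoetherianRing Λ] [IsNoetherianRing Λᵐᵒᵖ] (n : ℕ)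
    (hr : ∀ (X : Type u) [AddCommGroup X] [Module Λᵐᵒᵖ X] (j : ℕ), n < j → VE Λᵐᵒᵖ j X Λ)
    (G : Type u) [AddCommGroup G] [Module Λ G] [Module.Finite Λ G] (hG : GP Λ G) :
    ∃ (m : ℕ) (f : G →ₗ[Λ] (Fin m → Λ)), Function.Injective f ∧
      GP Λ ((Fin m → Λ) ⧸ LinearMap.range f) := by
  have hfin : Module.Finite Λᵐᵒᵖ (G →ₗ[Λ] Λ) := by
    obtain ⟨m, g, hg⟩ := Module.Finite.exists_fin' Λ G
    exact Module.Finite.of_injective (dmap g) (dmap_inj hg)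
  obtain ⟨m, s, hs⟩ := Module.Finite.exists_fin' Λᵐᵒᵖ (G →ₗ[Λ] Λ)
  let f : G →ₗ[Λ] (Fin m → Λ) := LinearMap.pi fun i => s (Pi.single i 1)
  have key : ∀ φ : G →ₗ[Λ] Λ, ∃ ψ : (Fin m → Λ) →ₗ[Λ] Λ, ψ ∘ₗ f = φ := by
    intro φ
    obtain ⟨c, rfl⟩ := hs φ
    refine ⟨∑ i, c i • (LinearMap.proj i : (Fin m → Λ) →ₗ[Λ] Λ), ?_⟩
    conv_rhs => rw [pi_eq_sum_univ' c, map_sum]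
    ext x
    simp [f, LinearMap.sum_apply]
  have hf : Function.Injective f := by
    rw [injective_iff_map_eq_zero]
    intro x hx
    refine torsionless n hr G hG x fun φ => ?_
    obtain ⟨ψ, rfl⟩ := key φ
    simp [hx]
  refine ⟨m, f, hf, fun j => ?_⟩
  have he := LinearMap.exact_map_mkQ_range f
  have hq := Submodule.mkQ_surjective (LinearMap.range f)
  cases j with
  | zero => exact VE.of_extend hf he hq key
  | succ j => exact VE.contra₃ hf he hq (hG j) (VE.proj _)

end D

section E
variable {Λ : Type u} [Ring Λ] {A B C M N : Type u} [AddCommGroup A] [Module Λ A]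
  [AddCommGroup B] [Module Λ B] [AddCommGroup C] [Module Λ C] [AddCommGroup N] [Module Λ N]
  [AddCommGroup M] [Module Λ M]

lemma exists_factor {g : B →ₗ[Λ] C} (hg : Function.Surjective g) (φ : B →ₗ[Λ] N)
    (hk : ∀ x, g x = 0 → φ x = 0) : ∃ ψ : C →ₗ[Λ] N, ∀ x, ψ (g x) = φ x := by
  refine ⟨(LinearMap.ker g).liftQ φ hk ∘ₗ (g.quotKerEquivOfSurjective hg).symm.toLinearMap, ?_⟩
  intro x
  have : (g.quotKerEquivOfSurjective hg).symm (g x) = (LinearMap.ker g).mkQ x := by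
    rw [LinearEquiv.symm_apply_eq]; rfl
  simp only [LinearMap.comp_apply, LinearEquiv.coe_coe, this]
  rfl

lemma pushout {F Y X : Type u} [AddCommGroup F] [Module Λ F] [AddCommGroup Y] [Module Λ Y]
    [AddCommGroup X] [Module Λ X] [Module.Finite Λ F] [Module.Finite Λ Y]
    {f : A →ₗ[Λ] F} {g : F →ₗ[Λ] M} (hf : Function.Injective f) (hfg : Function.Exact f g)
    (hg : Function.Surjective g) {i : A →ₗ[Λ] Y} {p : Y →ₗ[Λ] X} (hi : Function.Injective i)
    (hip : Function.Exact i p) (hp : Function.Surjective p) :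
    ∃ (Z : Type u) (_ : AddCommGroup Z) (_ : Module Λ Z) (_ : Module.Finite Λ Z)
      (a : F →ₗ[Λ] Z) (s : Z →ₗ[Λ] X) (b : Y →ₗ[Λ] Z) (t : Z →ₗ[Λ] M),
      Function.Injective a ∧ Function.Exact a s ∧ Function.Surjective s ∧
      Function.Injective b ∧ Function.Exact b t ∧ Function.Surjective t := by
  let w : A →ₗ[Λ] F × Y := f.prod (-i)
  let W := LinearMap.range w
  have hwmem : ∀ x y, (x, y) ∈ W ↔ ∃ c, f c = x ∧ -i c = y := by
    intro x y
    simp [W, w, LinearMap.mem_range, Prod.ext_iff]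
  obtain ⟨s, hs⟩ := exists_factor (Submodule.mkQ_surjective W) (p ∘ₗ LinearMap.snd Λ F Y) (by
    rintro ⟨x, y⟩ h
    obtain ⟨c, rfl, rfl⟩ := (hwmem x y).1 (by simpa using h)
    simp [hip.apply_apply_eq_zero])
  obtain ⟨t, ht⟩ := exists_factor (Submodule.mkQ_surjective W) (g ∘ₗ LinearMap.fst Λ F Y) (by
    rintro ⟨x, y⟩ h
    obtain ⟨c, rfl, rfl⟩ := (hwmem x y).1 (by simpa using h)
    simp [hfg.apply_apply_eq_zero])
  refine ⟨(F × Y) ⧸ W, inferInstance, inferInstance, inferInstance,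
    W.mkQ ∘ₗ LinearMap.inl Λ F Y, s, W.mkQ ∘ₗ LinearMap.inr Λ F Y, t, ?_, ?_, ?_, ?_, ?_, ?_⟩
  · rw [injective_iff_map_eq_zero]
    intro x hx
    obtain ⟨c, rfl, h⟩ := (hwmem x 0).1 (by simpa using hx)
    have : c = 0 := hi (by simpa using h)
    simp [this]
  · intro z
    obtain ⟨⟨x, y⟩, rfl⟩ := Submodule.mkQ_surjective W z
    rw [hs]
    constructor
    · intro h
      obtain ⟨c, rfl⟩ := (hip y).1 h
      refine ⟨x + f c, ?_⟩
      rw [← sub_eq_zero, LinearMap.comp_apply, ← map_sub]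
      rw [Submodule.mkQ_apply, Submodule.Quotient.mk_eq_zero]
      refine (hwmem _ _).2 ⟨c, ?_, ?_⟩ <;> simp
    · rintro ⟨x', h⟩
      have := congrArg s h
      rw [LinearMap.comp_apply, hs, hs] at this
      rw [← this]; simp
  · intro x
    obtain ⟨y, rfl⟩ := hp x
    exact ⟨W.mkQ (0, y), hs _⟩
  · rw [injective_iff_map_eq_zero]
    intro x hx
    obtain ⟨c, h, rfl⟩ := (hwmem 0 x).1 (by simpa using hx)
    have : c = 0 := hf (by simpa using h)
    simp [this]
  · intro z
    obtain ⟨⟨x, y⟩, rfl⟩ := Submodule.mkQ_surjective W z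
    rw [ht]
    constructor
    · intro h
      obtain ⟨c, rfl⟩ := (hfg x).1 h
      refine ⟨y + i c, ?_⟩
      rw [← sub_eq_zero, LinearMap.comp_apply, ← map_sub]
      rw [Submodule.mkQ_apply, Submodule.Quotient.mk_eq_zero]
      refine (hwmem _ _).2 ⟨-c, ?_, ?_⟩ <;> simp
    · rintro ⟨x', h⟩
      have := congrArg t h
      rw [LinearMap.comp_apply, ht, ht] at this
      rw [← this]; simp
  · intro x
    obtain ⟨y, rfl⟩ := hg x
    exact ⟨W.mkQ (y, 0), ht _⟩

lemma approx [IsNoetherianRing Λ] [IsNoetherianRing Λᵐᵒᵖ] (n : ℕ)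
    (hr : ∀ (X : Type u) [AddCommGroup X] [Module Λᵐᵒᵖ X] (j : ℕ), n < j → VE Λᵐᵒᵖ j X Λ)
    (k : ℕ) : ∀ (M : Type u) [AddCommGroup M] [Module Λ M] [Module.Finite Λ M],
    (∀ j, k < j → VE Λ j M Λ) →
    ∃ (Y : Type u) (_ : AddCommGroup Y) (_ : Module Λ Y) (_ : Module.Finite Λ Y)
      (X : Type u) (_ : AddCommGroup X) (_ : Module Λ X)
      (i : M →ₗ[Λ] Y) (p : Y →ₗ[Λ] X), Function.Injective i ∧ Function.Exact i p ∧
      Function.Surjective p ∧ GP Λ X ∧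
      ∃ e : ℕ, ∀ (K : Type u) [AddCommGroup K] [Module Λ K] (j : ℕ), e < j → VE Λ j Y K := by
  induction k with
  | zero =>
    intro M _ _ _ h
    obtain ⟨m, f, hf, hX⟩ := embed n hr M fun j => h _ (Nat.succ_pos j)
    refine ⟨Fin m → Λ, inferInstance, inferInstance, inferInstance, _, inferInstance,
      inferInstance, f, (LinearMap.range f).mkQ, hf, LinearMap.exact_map_mkQ_range f,
      Submodule.mkQ_surjective _, hX, 0, fun K _ _ j hj => ?_⟩
    obtain ⟨j, rfl⟩ := Nat.exists_eq_succ_of_ne_zero hj.ne'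
    exact VE.proj j
  | succ k ih =>
    intro M _ _ _ h
    obtain ⟨m, g, hg⟩ := Module.Finite.exists_fin' Λ M
    have hfg := exact_subtype_ker g
    have hsub : Function.Injective (LinearMap.ker g).subtype := Subtype.val_injective
    obtain ⟨Y, _, _, _, X, _, _, i, p, hi, hip, hp, hX, e, he⟩ := ih (LinearMap.ker g) (by
      intro j hj
      obtain ⟨j, rfl⟩ := Nat.exists_eq_succ_of_ne_zero (Nat.ne_zero_of_lt hj)
      exact VE.contra₁ hsub hfg hg (VE.proj _) (h _ (by omega)))
    obtain ⟨Z, _, _, _, a, s, b, t, ha, has, hs, hb, hbt, ht⟩ :=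
      pushout hsub hfg hg hi hip hp
    have hZ : GP Λ Z := fun j => VE.contra₂ ha has hs (VE.proj j) (hX j)
    obtain ⟨q, f, hf, hX'⟩ := embed n hr Z hZ
    have hle : LinearMap.range (f ∘ₗ b) ≤ LinearMap.range f := LinearMap.range_comp_le_range _ _
    obtain ⟨i', hi'⟩ := exists_factor ht ((LinearMap.range (f ∘ₗ b)).mkQ ∘ₗ f) (by
      intro z hz
      obtain ⟨y, rfl⟩ := (hbt z).1 hz
      simp only [LinearMap.comp_apply, Submodule.mkQ_apply, Submodule.Quotient.mk_eq_zero]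
      exact ⟨y, rfl⟩)
    obtain ⟨p', hp'⟩ := exists_factor (Submodule.mkQ_surjective (LinearMap.range (f ∘ₗ b)))
      (LinearMap.range f).mkQ (by
        intro x hx
        simp only [Submodule.mkQ_apply, Submodule.Quotient.mk_eq_zero] at hx ⊢
        exact hle hx)
    refine ⟨(Fin q → Λ) ⧸ LinearMap.range (f ∘ₗ b), inferInstance, inferInstance, inferInstance,
      _, inferInstance, inferInstance, i', p', ?_, ?_, ?_, hX', e + 1, ?_⟩
    · rw [injective_iff_map_eq_zero]
      intro x hx
      obtain ⟨z, rfl⟩ := ht x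
      rw [hi'] at hx
      simp only [LinearMap.comp_apply, Submodule.mkQ_apply, Submodule.Quotient.mk_eq_zero] at hx
      obtain ⟨y, hy⟩ := hx
      rw [← hf hy]
      exact hbt.apply_apply_eq_zero y
    · intro y
      obtain ⟨x, rfl⟩ := Submodule.mkQ_surjective _ y
      rw [hp']
      constructor
      · intro hx
        obtain ⟨z, rfl⟩ : x ∈ LinearMap.range f := by simpa using hx
        exact ⟨t z, hi' z⟩
      · rintro ⟨w, hw⟩
        obtain ⟨z, rfl⟩ := ht w
        have := congrArg p' hw
        rw [hi', LinearMap.comp_apply, hp', hp'] at this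
        rw [← this]
        simp
    · intro x
      obtain ⟨y, rfl⟩ := Submodule.mkQ_surjective _ x
      exact ⟨_, hp' y⟩
    · intro K _ _ j hj
      obtain ⟨j, rfl⟩ := Nat.exists_eq_succ_of_ne_zero (Nat.ne_zero_of_lt hj)
      exact VE.contra₃ (f := f ∘ₗ b) (hf.comp hb) (LinearMap.exact_map_mkQ_range (f ∘ₗ b))
        (Submodule.mkQ_surjective _) (he K j (by omega)) (VE.proj j)

lemma subsingleton_extGrp_iff_VE {i : ℕ} (M N : ModuleCat.{u} Λ) (hi : 0 < i) :
    Subsingleton (ExtGrp Λ i M N) ↔ VE Λ i M N := by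
  obtain ⟨i, rfl⟩ := Nat.exists_eq_succ_of_ne_zero hi.ne'
  rw [subsingleton_extGrp_iff]
  exact ⟨fun h e => Subsingleton.elim _ _, fun h => subsingleton_of_forall_eq 0 h⟩

lemma PdLE_iff {k : ℕ} (M : ModuleCat.{u} Λ) : PdLE Λ k M ↔
    ∀ (K : Type u) [AddCommGroup K] [Module Λ K] (j : ℕ), k < j → VE Λ j M K :=
  ⟨fun h K _ _ j hj => (subsingleton_extGrp_iff_VE M (ModuleCat.of Λ K) (by omega)).1 (h _ j hj),
    fun h N j hj => (subsingleton_extGrp_iff_VE M N (by omega)).2 (h _ j hj)⟩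

lemma IdLE_iff {k : ℕ} (N : ModuleCat.{u} Λ) : IdLE Λ k N ↔
    ∀ (K : Type u) [AddCommGroup K] [Module Λ K] (j : ℕ), k < j → VE Λ j K N :=
  ⟨fun h K _ _ j hj => (subsingleton_extGrp_iff_VE (ModuleCat.of Λ K) N (by omega)).1 (h _ j hj),
    fun h M j hj => (subsingleton_extGrp_iff_VE M N (by omega)).2 (h _ j hj)⟩

end E

end Aux

/-!
The final Corollary of Section 4 of the paper (finitistic-dimension part):
if `Λ` is an `n`-Gorenstein Artin algebra (the injective dimensions of `Λ` as a left
module and as a right module are both equal to `n`), then `fin.dim(Λ) = n`: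
every finitely generated left `Λ`-module of finite projective dimension has
projective dimension at most `n`, and there is a finitely generated left `Λ`-module
of projective dimension exactly `n`.
-/

theorem findim_eq_of_gorenstein
    {R : Type u} [CommRing R] [IsArtinianRing R]
    {Λ : Type u} [Ring Λ] [Algebra R Λ] [Module.Finite R Λ]
    (n : ℕ)
    -- `Λ` has injective dimension exactly `n` as a left `Λ`-module:
    (hlLE : IdLE Λ n (ModuleCat.of Λ Λ))
    (hlGE : ∀ k : ℕ, IdLE Λ k (ModuleCat.of Λ Λ) → n ≤ k)
    -- `Λ` has injective dimension exactly `n` as a right `Λ`-module: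
    (hrLE : IdLE Λᵐᵒᵖ n (ModuleCat.of Λᵐᵒᵖ Λᵐᵒᵖ))
    (hrGE : ∀ k : ℕ, IdLE Λᵐᵒᵖ k (ModuleCat.of Λᵐᵒᵖ Λᵐᵒᵖ) → n ≤ k) :
    (∀ M : ModuleCat.{u} Λ, Module.Finite Λ M →
      (∃ k : ℕ, PdLE Λ k M) → PdLE Λ n M) ∧
    (∃ M : ModuleCat.{u} Λ, Module.Finite Λ M ∧ PdLE Λ n M ∧
      ∀ k : ℕ, PdLE Λ k M → n ≤ k) := by
  have : IsNoetherianRing Λ := IsNoetherianRing.of_finite R Λ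
  have : Module.Finite R Λᵐᵒᵖ := Module.Finite.equiv (MulOpposite.opLinearEquiv R)
  have : IsNoetherianRing Λᵐᵒᵖ := IsNoetherianRing.of_finite R Λᵐᵒᵖ
  have hl := (IdLE_iff _).1 hlLE
  have hr : ∀ (X : Type u) [AddCommGroup X] [Module Λᵐᵒᵖ X] (j : ℕ), n < j → VE Λᵐᵒᵖ j X Λ :=
    fun X _ _ j hj => VE.congr_right (opEquiv Λ) ((IdLE_iff _).1 hrLE X j hj)
  have part1 : ∀ M : ModuleCat.{u} Λ, Module.Finite Λ M →
      (∃ k : ℕ, PdLE Λ k M) → PdLE Λ n M := by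
    rintro M hM ⟨k, hk⟩
    rw [PdLE_iff] at hk ⊢
    exact pd_le n hl M k fun K _ _ j hj => hk K j (by omega)
  refine ⟨part1, ?_⟩
  cases n with
  | zero =>
    refine ⟨ModuleCat.of Λ Λ, inferInstanceAs (Module.Finite Λ Λ), (PdLE_iff _).2 ?_,
      fun k _ => Nat.zero_le k⟩
    intro K _ _ j hj
    obtain ⟨j, rfl⟩ := Nat.exists_eq_succ_of_ne_zero (Nat.ne_zero_of_lt hj)
    exact VE.proj (A := Λ) j
  | succ n =>
    obtain ⟨I, hI⟩ : ∃ I : Ideal Λ, ¬ VE Λ (n + 1) (Λ ⧸ I) Λ := by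
      by_contra! hcon
      have h1 := baer_step n Λ hcon
      have := hlGE n ((IdLE_iff _).2 fun K _ _ j hj => by
        obtain rfl | hj' := (Nat.succ_le_of_lt hj).eq_or_lt
        · exact h1 K
        · exact hl K j hj')
      omega
    obtain ⟨Y, _, _, hY, X, _, _, i, p, hi, hip, hp, hX, e, he⟩ :=
      approx (n + 1) hr (n + 1) (Λ ⧸ I) fun j hj => hl _ j hj
    refine ⟨ModuleCat.of Λ Y, hY, part1 _ hY ⟨e, (PdLE_iff _).2 he⟩, fun k hk => ?_⟩
    by_contra! hlt
    exact hI (VE.contra₁ hi hip hp ((PdLE_iff _).1 hk Λ (n + 1) hlt) (hX (n + 1)))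
end
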